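/- arXiv:1602.06440 — 2 statements merged into one kernel-verified Lean document; each statement's English description precedes it below -/
import Mathlib

section
/- There exists a constant C ≥ 1, depending only on D, L, and n, such that the following holds. Let (M,d) be a closed metric manifold of dimension n that is D-doubling, L-linearly locally contractible, and has diam(M) ≥ 1. Then there exist ℓ ≥ 1, a nonempty family F of nonempty subsets of {1,…,ℓ}, closed under taking nonempty subsets, with |σ| ≤ D+1 for every σ ∈ F, with associated standard simplicial complex 𝒮 = ⋃_{σ∈F} conv{e_i : i ∈ σ} ⊆ ℝ^ℓ, a C-Lipschitz map f : M → 𝒮, and a continuous map g : 𝒮 → M, such that: for every continuous map p : 𝒮 → 𝒮 satisfying p(conv{e_i : i ∈ σ}) ⊆ conv{e_i : i ∈ σ} for all σ ∈ F, there is a continuous homotopy h : [0,1] × M → M with h(0,x) = x and h(1,x) = g(p(f(x))) for all x ∈ M, and d(h(t,x), x) ≤ 1/4 for all x ∈ M and 0 ≤ t ≤ 1. -/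
open Metric MeasureTheory

/-- `M` is a topological `n`-manifold: every point has an open neighborhood
homeomorphic to an open subset of `ℝⁿ`. -/
def IsTopManifold (n : ℕ) (M : Type*) [TopologicalSpace M] : Prop :=
  ∀ x : M, ∃ (U : Set M) (V : Set (EuclideanSpace ℝ (Fin n))),
    IsOpen U ∧ x ∈ U ∧ IsOpen V ∧ Nonempty (U ≃ₜ V)

/-- `M` is `D`-doubling: every open ball `B(z,r)` contains at most `D` points that are
pairwise at distance `≥ r/2` from each other. -/
def IsDoubling (D : ℕ) (M : Type*) [MetricSpace M] : Prop :=
  ∀ (z : M) (r : ℝ) (s : Finset M), (↑s ⊆ ball z r) →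
    (∀ a ∈ s, ∀ b ∈ s, a ≠ b → r / 2 ≤ dist a b) → s.card ≤ D

/-- `M` is `L`-linearly locally contractible: every ball `B(z,r)` with
`0 < r ≤ diam M / L` can be contracted to a point inside `B(z,Lr)`. -/
def IsLLC (L : ℝ) (M : Type*) [MetricSpace M] : Prop :=
  ∀ (z : M) (r : ℝ), 0 < r → r ≤ diam (Set.univ : Set M) / L →
    ∃ h : ℝ → M → M,
      ContinuousOn (fun p : ℝ × M => h p.1 p.2) (Set.Icc 0 1 ×ˢ ball z r) ∧
      (∀ x ∈ ball z r, h 0 x = x) ∧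
      (∃ c : M, ∀ x ∈ ball z r, h 1 x = c) ∧
      (∀ t ∈ Set.Icc (0:ℝ) 1, ∀ x ∈ ball z r, h t x ∈ ball z (L * r))


/-- The geometric cell associated to a finite set `σ` of indices: the convex hull of the
corresponding standard basis vectors of `ℝ^ℓ`. -/
noncomputable def cellOf {ℓ : ℕ} (σ : Finset (Fin ℓ)) : Set (EuclideanSpace ℝ (Fin ℓ)) :=
  convexHull ℝ ((fun i => EuclideanSpace.single i (1 : ℝ)) '' (σ : Set (Fin ℓ)))

/-- The realization of the standard simplicial complex determined by a family `F` of
index sets: `𝒮 = ⋃_{σ ∈ F} conv{eᵢ : i ∈ σ} ⊆ ℝ^ℓ`. -/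
noncomputable def realization {ℓ : ℕ} (F : Finset (Finset (Fin ℓ))) :
    Set (EuclideanSpace ℝ (Fin ℓ)) :=
  ⋃ σ ∈ F, cellOf σ

section Simplex

open Set

/-- The probability vectors on `ι` supported in the finite set `σ`. -/
def simplexOn {ι : Type*} (σ : Finset ι) : Set (ι → ℝ) :=
  {w | (∀ i, 0 ≤ w i) ∧ (∀ i, i ∉ σ → w i = 0) ∧ ∑ i ∈ σ, w i = 1}

variable {ι : Type*} {σ τ : Finset ι} {w w' : ι → ℝ}

lemma isClosed_simplexOn (σ : Finset ι) : IsClosed (simplexOn σ) := by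
  simp only [simplexOn, ofPred_and, ofPred_forall]
  refine IsClosed.inter (isClosed_iInter fun i => ?_)
    (IsClosed.inter (isClosed_iInter fun i => isClosed_iInter fun _ => ?_) ?_)
  · exact isClosed_le (by fun_prop) (by fun_prop)
  · exact isClosed_eq (by fun_prop) (by fun_prop)
  · exact isClosed_eq (by fun_prop) (by fun_prop)

lemma simplexOn_mono (h : τ ⊆ σ) : simplexOn τ ⊆ simplexOn σ := by
  rintro w ⟨h0, h1, h2⟩
  refine ⟨h0, fun i hi => h1 i fun hi' => hi (h hi'), ?_⟩
  rw [← h2]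
  exact (Finset.sum_subset h fun i _ hi => h1 i hi).symm

lemma nonempty_of_mem_simplexOn (h : w ∈ simplexOn σ) : σ.Nonempty := by
  rw [Finset.nonempty_iff_ne_empty]
  rintro rfl
  simpa using h.2.2

lemma mem_simplexOn_of_support_subset (h : w ∈ simplexOn σ) (hs : ∀ i ∈ σ, w i ≠ 0 → i ∈ τ)
    (hτ : τ ⊆ σ) : w ∈ simplexOn τ := by
  refine ⟨h.1, fun i hi => ?_, ?_⟩
  · by_cases hσ : i ∈ σ
    · by_contra h0
      exact hi (hs i hσ h0)
    · exact h.2.1 i hσ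
  · rw [← h.2.2]
    refine Finset.sum_subset hτ fun i hi hi' => ?_
    by_contra h0
    exact hi' (hs i hi h0)

lemma convex_simplexOn (σ : Finset ι) : Convex ℝ (simplexOn σ) := by
  rintro w ⟨h0, h1, h2⟩ w' ⟨h0', h1', h2'⟩ a b ha hb hab
  refine ⟨fun i => ?_, fun i hi => ?_, ?_⟩
  · have := h0 i
    have := h0' i
    simp only [Pi.add_apply, Pi.smul_apply, smul_eq_mul]
    positivity
  · simp [h1 i hi, h1' i hi]
  · simp only [Pi.add_apply, Pi.smul_apply, smul_eq_mul, Finset.sum_add_distrib,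
      ← Finset.mul_sum, h2, h2', mul_one, hab]

/-- A map that is continuous on each of finitely many simplices can be composed with a continuous
map into their union. -/
lemma continuousOn_comp_of_simplices {X M : Type*} [TopologicalSpace X] [TopologicalSpace M]
    {W : X → ι → ℝ} {A : Set X} {G : (ι → ℝ) → M} (V : Finset ι) (hW : ContinuousOn W A)
    (h : ∀ a ∈ A, ∃ σ ⊆ V, W a ∈ simplexOn σ ∧ ContinuousOn G (simplexOn σ)) :
    ContinuousOn (fun a => G (W a)) A := by
  let I := {σ : Finset ι // σ ∈ V.powerset ∧ ContinuousOn G (simplexOn σ)}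
  have : Finite I :=
    Finite.of_injective (fun s : I => (⟨s.1, s.2.1⟩ : V.powerset)) fun s t hst =>
      Subtype.ext (congrArg (fun u : V.powerset => u.1) hst)
  have hG : ContinuousOn G (⋃ s : I, simplexOn s.1) :=
    (locallyFinite_of_finite _).continuousOn_iUnion (fun s => isClosed_simplexOn _) fun s => s.2.2
  refine hG.comp hW fun a ha => ?_
  obtain ⟨σ, hσV, hσ, hc⟩ := h a ha
  exact mem_iUnion.2 ⟨⟨σ, Finset.mem_powerset.2 hσV, hc⟩, hσ⟩

/-- A continuous map from the boundary of a simplex into a set `B` that can be contracted to a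
point inside `B'` extends to the simplex, with values in `B'`. -/
lemma exists_extension_of_contraction {M : Type*} [TopologicalSpace M] [DecidableEq ι]
    (hσ : σ.Nonempty) {G : (ι → ℝ) → M} {B B' : Set M} {h : ℝ → M → M} {c : M} (hcB : c ∈ B')
    (hh : ContinuousOn (fun p : ℝ × M => h p.1 p.2) (Icc 0 1 ×ˢ B))
    (h0 : ∀ x ∈ B, h 0 x = x) (h1 : ∀ x ∈ B, h 1 x = c)
    (hB : ∀ t ∈ Icc (0 : ℝ) 1, ∀ x ∈ B, h t x ∈ B')
    (hG : ∀ i ∈ σ, ContinuousOn G (simplexOn (σ.erase i)))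
    (hGB : ∀ i ∈ σ, MapsTo G (simplexOn (σ.erase i)) B) :
    ∃ g : (ι → ℝ) → M, ContinuousOn g (simplexOn σ) ∧ MapsTo g (simplexOn σ) B' ∧
      ∀ i ∈ σ, EqOn g G (simplexOn (σ.erase i)) := by
  classical
  set m : (ι → ℝ) → ℝ := fun w => σ.inf' hσ w with hm
  set s : (ι → ℝ) → ℝ := fun w => 1 - σ.card * m w with hs
  set W : (ι → ℝ) → ι → ℝ := fun w i => if i ∈ σ then (w i - m w) / s w else 0 with hW
  have hmc : Continuous m := by
    have : m = fun w => σ.inf' hσ fun i => w i := rfl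
    rw [this]
    exact Continuous.finset_inf'_apply hσ fun i _ => continuous_apply i
  have hsc : Continuous s := by fun_prop
  have hle : ∀ w, ∀ i ∈ σ, m w ≤ w i := fun w i hi => Finset.inf'_le _ hi
  have hm0 : ∀ w ∈ simplexOn σ, 0 ≤ m w := fun w hw => Finset.le_inf' _ _ fun i _ => hw.1 i
  have hs1 : ∀ w ∈ simplexOn σ, s w ≤ 1 := fun w hw => by
    have := hm0 w hw
    have : 0 ≤ σ.card * m w := by positivity
    simp only [hs]; linarith
  have hWmem : ∀ w ∈ simplexOn σ, 1 / 2 ≤ s w → ∃ i ∈ σ, W w ∈ simplexOn (σ.erase i) := by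
    intro w hw hsw
    obtain ⟨i, hi, hmi⟩ := Finset.exists_mem_eq_inf' hσ w
    refine ⟨i, hi, ?_⟩
    have hWσ : W w ∈ simplexOn σ := by
      refine ⟨fun j => ?_, fun j hj => by simp [hW, hj], ?_⟩
      · by_cases hj : j ∈ σ
        · simp only [hW, hj, if_true]
          exact div_nonneg (sub_nonneg.2 (hle w j hj)) (by linarith)
        · simp [hW, hj]
      · have : ∑ j ∈ σ, W w j = ∑ j ∈ σ, (w j - m w) / s w :=
          Finset.sum_congr rfl fun j hj => by simp [hW, hj]
        rw [this, ← Finset.sum_div, Finset.sum_sub_distrib, hw.2.2, Finset.sum_const, nsmul_eq_mul]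
        exact div_self (by linarith)
    refine mem_simplexOn_of_support_subset hWσ (fun j hj hne => ?_) (Finset.erase_subset _ _)
    refine Finset.mem_erase.2 ⟨?_, hj⟩
    rintro rfl
    apply hne
    simp [hW, hm, hmi]
  have hWc : ContinuousOn W (simplexOn σ ∩ {w | 1 / 2 ≤ s w}) := by
    refine continuousOn_pi.2 fun i => ?_
    by_cases hi : i ∈ σ
    · simp only [hW, hi, if_true]
      refine ContinuousOn.div (by fun_prop) hsc.continuousOn fun w hw => ?_
      have : 1 / 2 ≤ s w := hw.2
      linarith
    · simp only [hW, hi, if_false]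
      exact continuousOn_const
  have hGW : ContinuousOn (fun w => G (W w)) (simplexOn σ ∩ {w | 1 / 2 ≤ s w}) := by
    refine continuousOn_comp_of_simplices σ hWc fun w hw => ?_
    obtain ⟨i, hi, hmem⟩ := hWmem w hw.1 hw.2
    exact ⟨_, Finset.erase_subset _ _, hmem, hG i hi⟩
  have hGWB : ∀ w ∈ simplexOn σ, 1 / 2 ≤ s w → G (W w) ∈ B := fun w hw hsw => by
    obtain ⟨i, hi, hmem⟩ := hWmem w hw hsw
    exact hGB i hi hmem
  have ht : ∀ w ∈ simplexOn σ, 1 / 2 ≤ s w → 2 * (1 - s w) ∈ Icc (0 : ℝ) 1 := fun w hw hsw => by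
    have := hs1 w hw
    constructor <;> linarith
  refine ⟨fun w => if 1 / 2 ≤ s w then h (2 * (1 - s w)) (G (W w)) else c, ?_, ?_, ?_⟩
  · refine ContinuousOn.if (fun w hw => ?_) ?_ continuousOn_const
    · have hsw : 1 / 2 = s w := frontier_le_subset_eq continuous_const hsc hw.2
      rw [← hsw, show (2 : ℝ) * (1 - 1 / 2) = 1 by norm_num]
      exact h1 _ (hGWB w hw.1 hsw.le)
    · rw [(isClosed_le continuous_const hsc).closure_eq]
      exact hh.comp (f := fun w => (2 * (1 - s w), G (W w)))
        (ContinuousOn.prodMk (by fun_prop) hGW)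
        fun w hw => ⟨ht w hw.1 hw.2, hGWB w hw.1 hw.2⟩
  · intro w hw
    dsimp only
    split_ifs with hsw
    · exact hB _ (ht w hw hsw) _ (hGWB w hw hsw)
    · exact hcB
  · intro i hi w hw
    have hw' : w ∈ simplexOn σ := simplexOn_mono (Finset.erase_subset _ _) hw
    have hwi : w i = 0 := hw.2.1 i (Finset.notMem_erase _ _)
    have hmw : m w = 0 := le_antisymm (hwi ▸ hle w i hi) (hm0 w hw')
    have hsw : s w = 1 := by simp [hs, hmw]
    have hWw : W w = w := by
      funext j
      by_cases hj : j ∈ σ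
      · simp [hW, hj, hmw, hsw]
      · simp [hW, hj, hw'.2.1 j hj]
    have hb : 1 / 2 ≤ s w := by rw [hsw]; norm_num
    have := hGWB w hw' hb
    rw [hWw] at this
    dsimp only
    rw [if_pos hb, hWw, hsw, sub_self, mul_zero]
    exact h0 _ this

end Simplex

section Filling

open Set

variable {M : Type*} [MetricSpace M]

/-- In a linearly locally contractible space, simplices with vertices in a small ball can be filled
in, compatibly with faces, inside a ball of comparable radius. -/
lemma IsLLC.exists_filling {L : ℝ} (hL : 1 ≤ L) (hM : IsLLC L M)
    (hdiam : 1 ≤ diam (univ : Set M)) (k : ℕ) :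
    ∃ G : (M → ℝ) → M, ∀ σ : Finset M, σ.Nonempty → σ.card ≤ k + 1 → ∀ (a : M) (r : ℝ),
      r * (5 * L) ^ k ≤ 1 → ↑σ ⊆ ball a r →
      ContinuousOn G (simplexOn σ) ∧ MapsTo G (simplexOn σ) (ball a ((5 * L) ^ k * r)) := by
  classical
  have : Nonempty M := by
    by_contra h
    rw [not_nonempty_iff] at h
    simp [univ_eq_empty_iff.2 h] at hdiam
    linarith
  induction k with
  | zero =>
    refine ⟨fun w => if h : ∃ x, w x ≠ 0 then h.choose else Classical.arbitrary M, ?_⟩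
    intro σ hne hcard a r _ hσ
    obtain ⟨x, rfl⟩ := Finset.card_eq_one.1 (le_antisymm hcard hne.card_pos)
    have hx1 : ∀ w ∈ simplexOn {x}, w x = 1 := fun w hw => by simpa using hw.2.2
    refine ⟨Set.Subsingleton.continuousOn (fun w hw w' hw' => ?_) _, fun w hw => ?_⟩
    · funext y
      by_cases hy : y = x
      · rw [hy, hx1 w hw, hx1 w' hw']
      · rw [hw.2.1 y (by simpa using hy), hw'.2.1 y (by simpa using hy)]
    · have h : ∃ y, w y ≠ 0 := ⟨x, by simp [hx1 w hw]⟩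
      have hc : h.choose = x := by
        by_contra hne
        exact h.choose_spec (hw.2.1 _ (by simpa using hne))
      simp only [h, dif_pos, hc]
      simpa using hσ
  | succ k ih =>
    obtain ⟨G, hG⟩ := ih
    have hP1 : 1 ≤ (5 * L) ^ k := one_le_pow₀ (by linarith)
    set P := (5 * L) ^ k with hP
    have hPs : (5 * L) ^ (k + 1) = 5 * L * P := by rw [hP]; ring
    rw [hPs]
    have key : ∀ σ : Finset M, σ.card = k + 2 →
        (∃ a r, r * (5 * L * P) ≤ 1 ∧ (σ : Set M) ⊆ ball a r) →
        ∃ g : (M → ℝ) → M, ContinuousOn g (simplexOn σ) ∧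
          (∀ (a : M) (r : ℝ), (σ : Set M) ⊆ ball a r →
            MapsTo g (simplexOn σ) (ball a (5 * L * P * r))) ∧
          ∀ i ∈ σ, EqOn g G (simplexOn (σ.erase i)) := by
      rintro σ hcard ⟨a, r, hr, hσ⟩
      have hone : 1 < σ.card := by omega
      obtain ⟨x, hx, y, hy, hxy⟩ := Finset.one_lt_card.1 hone
      have hbdd : Bornology.IsBounded (σ : Set M) := σ.finite_toSet.isBounded
      set δ := diam (σ : Set M) with hδ
      have hδ0 : 0 < δ := (dist_pos.2 hxy).trans_le (dist_le_diam_of_mem hbdd hx hy)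
      have hδr : ∀ (a : M) (r : ℝ), (σ : Set M) ⊆ ball a r → δ ≤ 2 * r := by
        intro a r h
        have hr0 : 0 ≤ r := (dist_nonneg.trans_lt (h hx)).le
        exact (diam_mono h isBounded_ball).trans (diam_ball hr0)
      have hσx : (σ : Set M) ⊆ ball x (2 * δ) := fun z hz => by
        have := dist_le_diam_of_mem hbdd hz (Finset.mem_coe.2 hx)
        rw [mem_ball]
        linarith
      have hPL : P ≤ L * P := by nlinarith
      have hsmall : 2 * δ * (L * P) ≤ 1 := by
        have := hδr a r hσ
        have h2 : 2 * δ * (L * P) ≤ 4 * r * (L * P) :=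
          mul_le_mul_of_nonneg_right (by linarith) (by linarith)
        have h3 : 0 ≤ r * (L * P) :=
          mul_nonneg (dist_nonneg.trans_lt (hσ hx)).le (by linarith)
        nlinarith
      have hG' : ∀ i ∈ σ, ContinuousOn G (simplexOn (σ.erase i)) ∧
          MapsTo G (simplexOn (σ.erase i)) (ball x (P * (2 * δ))) := by
        intro i hi
        have hc : (σ.erase i).card = k + 1 := by rw [Finset.card_erase_of_mem hi, hcard]; rfl
        refine hG _ (Finset.card_pos.1 (by omega)) hc.le x (2 * δ) ?_ ?_
        · exact (mul_le_mul_of_nonneg_left hPL (by linarith)).trans hsmall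
        · exact (Finset.coe_subset.2 (Finset.erase_subset _ _)).trans hσx
      have hρ : 0 < P * (2 * δ) := by positivity
      obtain ⟨h, hh, h0, ⟨c, h1⟩, hB⟩ := hM x (P * (2 * δ)) hρ (by
        rw [le_div_iff₀ (by linarith)]
        nlinarith)
      have hcB : c ∈ ball x (L * (P * (2 * δ))) := by
        rw [← h1 x (mem_ball_self hρ)]
        exact hB 1 (by simp) x (mem_ball_self hρ)
      obtain ⟨g, hgc, hgB, hgG⟩ := exists_extension_of_contraction ⟨x, hx⟩ hcB hh h0 h1 hB
        (fun i hi => (hG' i hi).1) (fun i hi => (hG' i hi).2)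
      refine ⟨g, hgc, fun a r h w hw => ?_, hgG⟩
      have hw' := hgB hw
      rw [mem_ball] at hw' ⊢
      have hxa : dist x a < r := h hx
      have hδ2 := hδr a r h
      have hLP : 1 ≤ L * P := hP1.trans hPL
      have h4 : L * (P * (2 * δ)) ≤ 4 * (L * P * r) := by
        have : L * P * δ ≤ L * P * (2 * r) := by gcongr
        nlinarith
      have h5 : r ≤ L * P * r := le_mul_of_one_le_left (dist_nonneg.trans hxa.le) hLP
      linarith [dist_triangle (g w) x a]
    choose! g hgc hgB hgG using key
    set good : Finset M → Prop := fun σ => σ.card = k + 2 ∧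
      ∃ a r, r * (5 * L * P) ≤ 1 ∧ (σ : Set M) ⊆ ball a r with hgood
    refine ⟨fun w => if h : ∃ σ, good σ ∧ ∀ i, i ∈ σ ↔ w i ≠ 0 then g h.choose w else G w, ?_⟩
    intro σ hne hcard a r hr hσ
    rcases hcard.lt_or_eq with hlt | heq
    · have hEq : EqOn (fun w => if h : ∃ σ, good σ ∧ ∀ i, i ∈ σ ↔ w i ≠ 0
          then g h.choose w else G w) G (simplexOn σ) := by
        intro w hw
        refine dif_neg ?_
        rintro ⟨τ, hτ, hτw⟩
        have hsub : τ ⊆ σ := fun i hi => by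
          by_contra hi'
          exact (hτw i).1 hi (hw.2.1 i hi')
        have := Finset.card_le_card hsub
        have := hτ.1
        omega
      have hr0 : 0 < r := by
        obtain ⟨x, hx⟩ := hne
        exact dist_nonneg.trans_lt (hσ hx)
      have hP5 : P ≤ 5 * L * P := by nlinarith
      obtain ⟨h1, h2⟩ := hG σ hne (by omega) a r
        ((mul_le_mul_of_nonneg_left hP5 hr0.le).trans hr) hσ
      refine ⟨h1.congr hEq, (h2.congr hEq.symm).mono_right (ball_subset_ball ?_)⟩
      gcongr
    · have hσg : good σ := ⟨heq, a, r, hr, hσ⟩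
      have hEq : EqOn (fun w => if h : ∃ σ, good σ ∧ ∀ i, i ∈ σ ↔ w i ≠ 0
          then g h.choose w else G w) (g σ) (simplexOn σ) := by
        intro w hw
        dsimp only
        split_ifs with h
        · obtain ⟨hτ, hτw⟩ := h.choose_spec
          have hsub : h.choose ⊆ σ := fun i hi => by
            by_contra hi'
            exact (hτw i).1 hi (hw.2.1 i hi')
          rw [Finset.eq_of_subset_of_card_le hsub (by rw [hτ.1, heq])]
        · obtain ⟨i, hi, hwi⟩ : ∃ i ∈ σ, w i = 0 := by
            by_contra! hall
            refine h ⟨σ, hσg, fun i => ⟨hall i, fun hi => ?_⟩⟩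
            by_contra hi'
            exact hi (hw.2.1 i hi')
          refine (hgG σ hσg.1 hσg.2 i hi ?_).symm
          refine mem_simplexOn_of_support_subset hw (fun j hj hne => ?_) (Finset.erase_subset _ _)
          refine Finset.mem_erase.2 ⟨?_, hj⟩
          rintro rfl
          exact hne hwi
      exact ⟨(hgc σ hσg.1 hσg.2).congr hEq, (hgB σ hσg.1 hσg.2 a r hσ).congr hEq.symm⟩

end Filling

section Partition

open Set

variable {M : Type*} [MetricSpace M] [CompactSpace M]

/-- A compact metric space has a finite `ε`-net whose points are pairwise `ε`-separated. -/
lemma exists_separated_net {ε : ℝ} (hε : 0 < ε) :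
    ∃ V : Finset M, (∀ x, ∃ v ∈ V, dist x v ≤ ε) ∧ ∀ a ∈ V, ∀ b ∈ V, a ≠ b → ε ≤ dist a b := by
  lift ε to NNReal using hε.le
  have hε' : 0 < ε := by exact_mod_cast hε
  have hfin : packingNumber ε (univ : Set M) ≠ ⊤ := by
    have h2 : 2 * (ε / 2) = ε := by field_simp
    have h := packingNumber_two_mul_le_externalCoveringNumber (ε / 2) (univ : Set M)
    rw [h2] at h
    obtain ⟨N, _, hN, hc⟩ := exists_finite_isCover_of_isCompact (ε := ε / 2)
      (half_pos hε').ne' (isCompact_univ : IsCompact (univ : Set M))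
    refine ((h.trans (iInf₂_le N hc)).trans_lt hN.encard_lt_top).ne
  have hVfin : (maximalSeparatedSet ε (univ : Set M)).Finite := by
    rw [← encard_lt_top_iff, encard_maximalSeparatedSet hfin]
    exact hfin.lt_top
  refine ⟨hVfin.toFinset, fun x => ?_, fun a ha b hb hab => ?_⟩
  · obtain ⟨v, hv, hxv⟩ := isCover_maximalSeparatedSet hfin (mem_univ x)
    have h : edist x v ≤ ε := hxv
    rw [edist_nndist] at h
    exact ⟨v, hVfin.mem_toFinset.2 hv, by exact_mod_cast h⟩
  · have h : ε < edist a b := isSeparated_maximalSeparatedSet (hVfin.mem_toFinset.1 ha)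
      (hVfin.mem_toFinset.1 hb) hab
    rw [edist_nndist] at h
    exact_mod_cast h.le

/-- In a compact doubling space there are, at every scale, finite partitions of unity with
controlled multiplicity and Lipschitz constant. -/
lemma IsDoubling.exists_partition {D : ℕ} (hM : IsDoubling D M) {ε : ℝ} (hε : 0 < ε) :
    ∃ (V : Finset M) (φ : M → M → ℝ),
      (∀ (x : M) (σ : Finset M), σ ⊆ V → ↑σ ⊆ ball x (2 * ε) → σ.card ≤ D) ∧
      Continuous φ ∧
      (∀ x, ∃ σ ⊆ V, ↑σ ⊆ ball x (2 * ε) ∧ φ x ∈ simplexOn σ) ∧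
      ∀ x y, ∑ v ∈ V, |φ x v - φ y v| ≤ 4 * D / ε * dist x y := by
  classical
  obtain ⟨V, hcov, hsep⟩ := exists_separated_net (M := M) hε
  set u : M → M → ℝ := fun x v => max 0 (2 * ε - dist x v) with hu
  set S : M → ℝ := fun x => ∑ v ∈ V, u x v with hS
  have hu0 : ∀ x v, 0 ≤ u x v := fun x v => le_max_left _ _
  have huz : ∀ x v, v ∉ ball x (2 * ε) → u x v = 0 := fun x v hv => by
    rw [mem_ball, dist_comm] at hv
    exact max_eq_left (by linarith)
  have hSε : ∀ x, ε ≤ S x := fun x => by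
    obtain ⟨v, hv, hxv⟩ := hcov x
    have h1 : ε ≤ u x v := le_max_of_le_right (by linarith)
    exact h1.trans (Finset.single_le_sum (fun w _ => hu0 x w) hv)
  have hS0 : ∀ x, 0 < S x := fun x => hε.trans_le (hSε x)
  have hcard : ∀ (x : M) (σ : Finset M), σ ⊆ V → ↑σ ⊆ ball x (2 * ε) → σ.card ≤ D :=
    fun x σ hσ hb => hM x (2 * ε) σ hb fun a ha b hb hab => by
      have := hsep a (hσ ha) b (hσ hb) hab
      linarith
  have huc : ∀ v, Continuous fun x => u x v := fun v => by fun_prop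
  have hSc : Continuous S := continuous_finsetSum _ fun v _ => huc v
  refine ⟨V, fun x v => if v ∈ V then u x v / S x else 0, hcard, ?_, fun x => ?_, fun x y => ?_⟩
  · refine continuous_pi fun v => ?_
    by_cases hv : v ∈ V
    · simp only [hv, if_true]
      exact (huc v).div hSc fun x => (hS0 x).ne'
    · simp only [hv, if_false]
      exact continuous_const
  · refine ⟨V.filter fun v => v ∈ ball x (2 * ε), Finset.filter_subset _ _,
      fun v hv => (Finset.mem_filter.1 hv).2, fun v => ?_, fun v hv => ?_, ?_⟩
    · dsimp only
      split_ifs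
      · exact div_nonneg (hu0 x v) (hS0 x).le
      · exact le_rfl
    · dsimp only
      split_ifs with hvV
      · have : v ∉ ball x (2 * ε) := fun h => hv (Finset.mem_filter.2 ⟨hvV, h⟩)
        rw [huz x v this, zero_div]
      · rfl
    · rw [Finset.sum_congr rfl fun v hv => if_pos (Finset.mem_filter.1 hv).1, ← Finset.sum_div,
        div_eq_one_iff_eq (hS0 x).ne']
      refine Finset.sum_subset (Finset.filter_subset _ _) fun v hv hv' => huz x v fun h => ?_
      exact hv' (Finset.mem_filter.2 ⟨hv, h⟩)
  · set T := ∑ v ∈ V, |u x v - u y v| with hT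
    have hTle : T ≤ 2 * D * dist x y := by
      set A : M → Finset M := fun z => V.filter fun v => v ∈ ball z (2 * ε) with hA
      have hAD : ∀ z, ((A z).card : ℝ) ≤ D := fun z => by
        exact_mod_cast hcard z _ (Finset.filter_subset _ _) fun v hv => (Finset.mem_filter.1 hv).2
      have hsub : A x ∪ A y ⊆ V :=
        Finset.union_subset (Finset.filter_subset _ _) (Finset.filter_subset _ _)
      have hT' : T = ∑ v ∈ A x ∪ A y, |u x v - u y v| := by
        refine (Finset.sum_subset hsub fun v hv hv' => ?_).symm
        simp only [hA, Finset.mem_union, Finset.mem_filter, hv, true_and, not_or] at hv'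
        rw [huz x v hv'.1, huz y v hv'.2, sub_self, abs_zero]
      rw [hT']
      have hle : ∀ v ∈ A x ∪ A y, |u x v - u y v| ≤ dist x y := fun v _ => by
        have h1 := abs_max_sub_max_le_abs (2 * ε - dist x v) (2 * ε - dist y v) 0
        have h2 := abs_dist_sub_le x y v
        rw [max_comm, max_comm _ (0 : ℝ), sub_sub_sub_cancel_left, abs_sub_comm (dist y v)] at h1
        exact h1.trans h2
      refine (Finset.sum_le_card_nsmul _ _ _ hle).trans ?_
      rw [nsmul_eq_mul]
      have hc : ((A x ∪ A y).card : ℝ) ≤ (A x).card + (A y).card := by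
        exact_mod_cast Finset.card_union_le _ _
      have := hAD x
      have := hAD y
      gcongr
      linarith
    have hST : |S y - S x| ≤ T := by
      rw [abs_sub_comm, hS, hT]
      simp only [← Finset.sum_sub_distrib]
      exact Finset.abs_sum_le_sum_abs _ _
    have hterm : ∀ v ∈ V, |(if v ∈ V then u x v / S x else 0) - (if v ∈ V then u y v / S y else 0)|
        ≤ |u x v - u y v| / S x + u y v / S y * (|S y - S x| / S x) := by
      intro v hv
      simp only [hv, if_true]
      have : u x v / S x - u y v / S y
          = (u x v - u y v) / S x + u y v / S y * ((S y - S x) / S x) := by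
        have := (hS0 x).ne'
        have := (hS0 y).ne'
        field_simp
        ring
      rw [this]
      refine (abs_add_le _ _).trans ?_
      rw [abs_div, abs_mul, abs_div, abs_div, abs_of_pos (hS0 x), abs_of_pos (hS0 y),
        abs_of_nonneg (hu0 y v)]
    refine (Finset.sum_le_sum hterm).trans ?_
    rw [Finset.sum_add_distrib, ← Finset.sum_div, ← Finset.sum_mul, ← Finset.sum_div]
    have hSy : (∑ v ∈ V, u y v) / S y = 1 := div_self (hS0 y).ne'
    rw [hSy, one_mul, ← hT]
    have hT0 : 0 ≤ T := Finset.sum_nonneg fun v _ => abs_nonneg _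
    calc T / S x + |S y - S x| / S x ≤ T / ε + T / ε := by
          gcongr <;> exact hSε x
      _ ≤ 2 * D * dist x y / ε + 2 * D * dist x y / ε := by gcongr
      _ = 4 * D / ε * dist x y := by ring

end Partition

section Concatenation

open Set Filter Topology

/-- Infinitely many homotopies, each beginning where the next one ends and converging uniformly to
the identity, can be concatenated to a homotopy that begins at the identity. -/
lemma exists_homotopy_of_seq {M : Type*} [MetricSpace M] {H : ℕ → ℝ → M → M} {η : ℕ → ℝ} {c : ℝ}
    (hη : Tendsto η atTop (𝓝 0)) (hηc : ∀ j, η j ≤ c)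
    (hc : ∀ j, ContinuousOn (fun q : ℝ × M => H j q.1 q.2) (Icc 0 1 ×ˢ univ))
    (hglue : ∀ j x, H j 1 x = H (j + 1) 0 x)
    (hd : ∀ j, ∀ t ∈ Icc (0 : ℝ) 1, ∀ x, dist (H j t x) x ≤ η j) :
    ∃ h : ℝ → M → M, ContinuousOn (fun q : ℝ × M => h q.1 q.2) (Icc 0 1 ×ˢ univ) ∧
      (∀ x, h 0 x = x) ∧ (∀ x, h 1 x = H 0 0 x) ∧
      ∀ t ∈ Icc (0 : ℝ) 1, ∀ x, dist (h t x) x ≤ c := by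
  set Φ : ℝ × M → M := fun q => H ⌊q.1⌋₊ (q.1 - ⌊q.1⌋₊) q.2 with hΦ
  have hfr : ∀ s : ℝ, 0 ≤ s → s - ⌊s⌋₊ ∈ Icc (0 : ℝ) 1 := fun s hs => by
    have := Nat.floor_le hs
    have := Nat.lt_floor_add_one s
    constructor <;> linarith
  have hΦc : ContinuousOn Φ (Ici 0 ×ˢ univ) := by
    have hlf : LocallyFinite fun m : ℕ =>
        (Prod.fst : ℝ × M → ℝ) ⁻¹' Icc (m : ℝ) (m + 1) := by
      have h1 : LocallyFinite fun m : ℤ => Icc (m : ℝ) (m + 1) :=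
        locallyFinite_Icc_of_tendsto tendsto_intCast_atTop_atTop
          (tendsto_atBot_add_const_right _ _ (tendsto_intCast_atBot_iff.2 tendsto_id))
      have h2 := (h1.comp_injective Nat.cast_injective).preimage_continuous
        (continuous_fst : Continuous (Prod.fst : ℝ × M → ℝ))
      simpa [Function.comp_def] using h2
    refine (hlf.continuousOn_iUnion (g := Φ) (fun m => isClosed_Icc.preimage continuous_fst)
      fun m => ?_).mono ?_
    · have hcm : ContinuousOn (fun q : ℝ × M => H m (q.1 - m) q.2)
          ((Prod.fst : ℝ × M → ℝ) ⁻¹' Icc (m : ℝ) (m + 1)) :=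
        (hc m).comp (f := fun q : ℝ × M => (q.1 - m, q.2)) (by fun_prop) fun q hq =>
          ⟨⟨by linarith [hq.1], by linarith [hq.2]⟩, mem_univ _⟩
      refine hcm.congr fun q hq => ?_
      rcases hq.2.lt_or_eq with hlt | heq
      · have : ⌊q.1⌋₊ = m := (Nat.floor_eq_iff (m.cast_nonneg.trans hq.1)).2 ⟨hq.1, hlt⟩
        simp only [hΦ, this]
      · have : ⌊q.1⌋₊ = m + 1 := by rw [heq]; exact_mod_cast Nat.floor_natCast (m + 1)
        simp only [hΦ, this]
        rw [heq]
        push_cast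
        rw [sub_self, add_sub_cancel_left, hglue]
    · rintro q ⟨hq, -⟩
      exact mem_iUnion.2 ⟨⌊q.1⌋₊, Nat.floor_le hq, (Nat.lt_floor_add_one _).le⟩
  have hΦd : ∀ s : ℝ, 0 ≤ s → ∀ x, dist (Φ (s, x)) x ≤ η ⌊s⌋₊ := fun s hs x =>
    hd _ _ (hfr s hs) x
  have hinv : ∀ t ∈ Icc (0 : ℝ) 1, 0 < t → 0 ≤ t⁻¹ - 1 := fun t ht h0 =>
    sub_nonneg.2 ((one_le_inv₀ h0).2 ht.2)
  refine ⟨fun t x => if t = 0 then x else Φ (t⁻¹ - 1, x), ?_, by simp, by simp [hΦ], ?_⟩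
  · rintro ⟨t, x⟩ ⟨ht, -⟩
    rcases ht.1.eq_or_lt with h0 | h0
    · have h0' : t = 0 := h0.symm
      subst h0'
      rw [ContinuousWithinAt]
      simp only [if_true]
      have hcl : Tendsto (fun q : ℝ × M => q.2) (𝓝[Icc 0 1 ×ˢ univ] ((0 : ℝ), x)) (𝓝 x) :=
        (continuous_snd.tendsto' _ _ rfl).mono_left nhdsWithin_le_nhds
      refine hcl.congr_dist ?_
      rw [Metric.tendsto_nhds]
      intro e he
      obtain ⟨N, hN⟩ := eventually_atTop.1 (hη.eventually (gt_mem_nhds he))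
      have hsmall : ∀ᶠ q : ℝ × M in 𝓝[Icc 0 1 ×ˢ univ] ((0 : ℝ), x), q.1 < ((N : ℝ) + 1)⁻¹ :=
        ((continuous_fst.tendsto' ((0 : ℝ), x) 0 rfl).mono_left nhdsWithin_le_nhds).eventually
          (gt_mem_nhds (by positivity))
      filter_upwards [hsmall, self_mem_nhdsWithin] with q hq hmem
      rw [Real.dist_eq, sub_zero, abs_of_nonneg dist_nonneg]
      by_cases hq0 : q.1 = 0
      · simpa [hq0] using he
      · have hqpos : 0 < q.1 := lt_of_le_of_ne hmem.1.1 (Ne.symm hq0)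
        simp only [hq0, if_false]
        rw [dist_comm]
        refine (hΦd _ (hinv _ hmem.1 hqpos) _).trans_lt (hN _ (Nat.le_floor ?_))
        have := (lt_inv_comm₀ hqpos (by positivity)).1 hq
        linarith
    · have hat : ContinuousWithinAt (fun q : ℝ × M => Φ (q.1⁻¹ - 1, q.2))
          (Icc 0 1 ×ˢ univ ∩ {q | 0 < q.1}) (t, x) := by
        refine (ContinuousOn.comp (f := fun q : ℝ × M => (q.1⁻¹ - 1, q.2)) hΦc ?_ ?_) (t, x)
          ⟨⟨ht, mem_univ _⟩, h0⟩
        · refine ContinuousOn.prodMk (ContinuousOn.sub (ContinuousOn.inv₀ (by fun_prop) ?_)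
            continuousOn_const) (by fun_prop)
          rintro q ⟨-, hq⟩
          exact (show 0 < q.1 from hq).ne'
        · rintro q ⟨hq, hq0⟩
          exact ⟨hinv _ hq.1 hq0, mem_univ _⟩
      have hnhds : {q : ℝ × M | 0 < q.1} ∈ 𝓝 (t, x) :=
        (isOpen_lt continuous_const continuous_fst).mem_nhds h0
      refine ((continuousWithinAt_inter hnhds).1 ?_)
      refine hat.congr (fun q hq => if_neg ?_) (if_neg h0.ne')
      exact (show 0 < q.1 from hq.2).ne'
  · intro t ht x
    by_cases h0 : t = 0
    · simp only [h0, if_true, dist_self]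
      exact (dist_nonneg.trans (hd 0 0 (by simp) x)).trans (hηc 0)
    · simp only [h0, if_false]
      exact (hΦd _ (hinv t ht (lt_of_le_of_ne ht.1 (Ne.symm h0))) x).trans (hηc _)

end Concatenation

section Main

open Set Filter Topology

lemma mem_cellOf_iff {ℓ : ℕ} {σ : Finset (Fin ℓ)} {w : EuclideanSpace ℝ (Fin ℓ)} :
    w ∈ cellOf σ ↔ (fun i => w i) ∈ simplexOn σ := by
  constructor
  · intro hw
    have hconv : Convex ℝ {w : EuclideanSpace ℝ (Fin ℓ) | (fun i => w i) ∈ simplexOn σ} :=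
      fun x hx y hy a b ha hb hab => convex_simplexOn σ hx hy ha hb hab
    refine convexHull_min ?_ hconv hw
    rintro _ ⟨i, hi, rfl⟩
    refine ⟨fun j => ?_, fun j hj => ?_, ?_⟩
    · simp only [PiLp.single_apply]
      split_ifs <;> norm_num
    · have : j ≠ i := fun h => hj (h ▸ hi)
      simp [this]
    · have hi' : i ∈ σ := hi
      simp [hi']
  · intro hw
    have hsum : w = ∑ i ∈ σ, w i • EuclideanSpace.single i (1 : ℝ) := by
      ext j
      by_cases hj : j ∈ σ
      · simp [Pi.single_apply, hj]
      · simp [Pi.single_apply, hj, hw.2.1 j hj]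
    rw [hsum]
    exact (convex_convexHull ℝ _).sum_mem (fun i _ => hw.1 i) hw.2.2
      fun i hi => subset_convexHull ℝ _ ⟨i, hi, rfl⟩

lemma EuclideanSpace.norm_le_sum_abs {ι : Type*} [Fintype ι] (w : EuclideanSpace ℝ ι) :
    ‖w‖ ≤ ∑ i, |w i| := by
  rw [EuclideanSpace.norm_eq]
  refine Real.sqrt_le_iff.2 ⟨Finset.sum_nonneg fun i _ => abs_nonneg _, ?_⟩
  simp only [Real.norm_eq_abs]
  exact Finset.sum_sq_le_sq_sum_of_nonneg fun i _ => abs_nonneg _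

open scoped Classical in
/-- Extension by zero of a vector indexed by an enumeration of the finite set `V`. -/
noncomputable def extendByZero {M : Type*} (V : Finset M)
    (w : EuclideanSpace ℝ (Fin V.card)) : M → ℝ :=
  fun y => if h : y ∈ V then w (V.equivFin ⟨y, h⟩) else 0

section ExtendByZero

variable {M : Type*} (V : Finset M)

/-- The enumeration of the finite set `V`. -/
noncomputable def enumEmbedding : Fin V.card ↪ M :=
  V.equivFin.symm.toEmbedding.trans (Function.Embedding.subtype _)

lemma enumEmbedding_mem (i : Fin V.card) : enumEmbedding V i ∈ V := (V.equivFin.symm i).2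

lemma extendByZero_enumEmbedding (w : EuclideanSpace ℝ (Fin V.card)) (i : Fin V.card) :
    extendByZero V w (enumEmbedding V i) = w i := by
  simp [extendByZero, enumEmbedding]

lemma exists_enumEmbedding_eq {y : M} (hy : y ∈ V) : ∃ i, enumEmbedding V i = y :=
  ⟨V.equivFin ⟨y, hy⟩, by simp [enumEmbedding]⟩

lemma sum_enumEmbedding (u : M → ℝ) : ∑ i, u (enumEmbedding V i) = ∑ v ∈ V, u v := by
  rw [← Finset.sum_coe_sort V, ← V.equivFin.symm.sum_comp]
  rfl

lemma continuous_extendByZero : Continuous (extendByZero V) := by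
  refine continuous_pi fun y => ?_
  by_cases hy : y ∈ V
  · simp only [extendByZero, hy, dif_pos]
    fun_prop
  · simp only [extendByZero, hy, dif_neg, not_false_eq_true]
    exact continuous_const

lemma extendByZero_mem_simplexOn_iff {τ : Finset (Fin V.card)}
    {w : EuclideanSpace ℝ (Fin V.card)} :
    extendByZero V w ∈ simplexOn (τ.map (enumEmbedding V)) ↔ (fun i => w i) ∈ simplexOn τ := by
  have hsum : ∑ y ∈ τ.map (enumEmbedding V), extendByZero V w y = ∑ i ∈ τ, w i := by
    rw [Finset.sum_map]
    exact Finset.sum_congr rfl fun i _ => extendByZero_enumEmbedding V w i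
  constructor
  · rintro ⟨h0, h1, h2⟩
    refine ⟨fun i => ?_, fun i hi => ?_, hsum ▸ h2⟩
    · dsimp only
      rw [← extendByZero_enumEmbedding V w i]
      exact h0 _
    · dsimp only
      rw [← extendByZero_enumEmbedding V w i]
      exact h1 _ (by simpa using hi)
  · rintro ⟨h0, h1, h2⟩
    refine ⟨fun y => ?_, fun y hy => ?_, hsum.trans h2⟩
    · by_cases hyV : y ∈ V
      · obtain ⟨i, rfl⟩ := exists_enumEmbedding_eq V hyV
        rw [extendByZero_enumEmbedding]
        exact h0 i
      · simp [extendByZero, hyV]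
    · by_cases hyV : y ∈ V
      · obtain ⟨i, rfl⟩ := exists_enumEmbedding_eq V hyV
        rw [extendByZero_enumEmbedding]
        exact h1 i (by simpa using hy)
      · simp [extendByZero, hyV]

lemma extendByZero_toLp {u : M → ℝ} (hu : ∀ y ∉ V, u y = 0) :
    extendByZero V (WithLp.toLp 2 fun i => u (enumEmbedding V i)) = u := by
  funext y
  by_cases hy : y ∈ V
  · obtain ⟨i, rfl⟩ := exists_enumEmbedding_eq V hy
    rw [extendByZero_enumEmbedding]
  · simp [extendByZero, hy, hu y hy]

lemma exists_map_enumEmbedding_eq {σ : Finset M} (hσ : σ ⊆ V) :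
    ∃ τ : Finset (Fin V.card), τ.map (enumEmbedding V) = σ := by
  classical
  refine ⟨Finset.univ.filter fun i => enumEmbedding V i ∈ σ, ?_⟩
  ext y
  simp only [Finset.mem_map, Finset.mem_filter, Finset.mem_univ, true_and]
  constructor
  · rintro ⟨i, hi, rfl⟩
    exact hi
  · intro hy
    obtain ⟨i, rfl⟩ := exists_enumEmbedding_eq V (hσ hy)
    exact ⟨i, hy, rfl⟩

end ExtendByZero

/-- **Proposition 4.3 (simplicial approximation).** There is `C ≥ 1` depending only on
`D`, `L`, `n` such that: every closed metric `n`-manifold `M` that is `D`-doubling,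
`L`-linearly locally contractible, with `diam M ≥ 1`, admits a standard simplicial complex
`𝒮 ⊆ ℝ^ℓ` of dimension at most `D`, a `C`-Lipschitz map `f : M → 𝒮`, and a continuous
map `g : 𝒮 → M`, such that for every continuous `p : 𝒮 → 𝒮` with `p(σ) ⊆ σ` for all
sub-simplices `σ`, the map `g ∘ p ∘ f` is homotopic to `id_M` via a homotopy moving points
by distance at most `1/4`. -/
theorem simplicial_approximation (n D : ℕ) (L : ℝ) (hD : 1 ≤ D) (hL : 1 ≤ L) :
    ∃ C : ℝ, 1 ≤ C ∧
      ∀ (M : Type) [MetricSpace M] [CompactSpace M],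
        IsTopManifold n M → IsDoubling D M → IsLLC L M →
        1 ≤ diam (Set.univ : Set M) →
        ∃ (ℓ : ℕ) (F : Finset (Finset (Fin ℓ)))
          (f : M → EuclideanSpace ℝ (Fin ℓ)) (g : EuclideanSpace ℝ (Fin ℓ) → M),
          1 ≤ ℓ ∧ F.Nonempty ∧
          (∀ σ ∈ F, σ.Nonempty ∧ σ.card ≤ D + 1) ∧
          (∀ σ ∈ F, ∀ τ ⊆ σ, τ.Nonempty → τ ∈ F) ∧
          LipschitzWith (Real.toNNReal C) f ∧
          (∀ x : M, f x ∈ realization F) ∧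
          ContinuousOn g (realization F) ∧
          (∀ p : EuclideanSpace ℝ (Fin ℓ) → EuclideanSpace ℝ (Fin ℓ),
            ContinuousOn p (realization F) →
            (∀ σ ∈ F, Set.MapsTo p (cellOf σ) (cellOf σ)) →
            ∃ h : ℝ → M → M,
              ContinuousOn (fun q : ℝ × M => h q.1 q.2)
                (Set.Icc 0 1 ×ˢ (Set.univ : Set M)) ∧
              (∀ x, h 0 x = x) ∧
              (∀ x, h 1 x = g (p (f x))) ∧
              (∀ t ∈ Set.Icc (0:ℝ) 1, ∀ x, dist (h t x) x ≤ 1 / 4)) := by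
  classical
  set K : ℝ := (5 * L) ^ (2 * D) with hK
  have hK1 : 1 ≤ K := one_le_pow₀ (by linarith)
  set ε : ℝ := 1 / (8 * K) with hε
  have hε0 : 0 < ε := by positivity
  have hKε : K * ε = 1 / 8 := by rw [hε]; field_simp
  have hε8 : ε ≤ 1 / 8 := by nlinarith
  set C : ℝ := 4 * D / ε with hC
  have hD' : (1 : ℝ) ≤ D := by exact_mod_cast hD
  have hC1 : 1 ≤ C := by
    rw [hC, le_div_iff₀ hε0]
    linarith
  refine ⟨C, hC1, ?_⟩
  intro M _ _ _ hdoub hllc hdiam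
  have hMne : Nonempty M := by
    by_contra h
    rw [not_nonempty_iff] at h
    simp [univ_eq_empty_iff.2 h] at hdiam
    linarith
  obtain ⟨G, hG⟩ := hllc.exists_filling hL hdiam (2 * D)
  rw [← hK] at hG
  have hε2 : ∀ j : ℕ, 0 < ε / 2 ^ j := fun j => by positivity
  have hεle : ∀ j : ℕ, ε / 2 ^ j ≤ ε := fun j => div_le_self hε0.le (one_le_pow₀ one_le_two)
  choose V φ hcard hφc hφσ hφL using fun j : ℕ => hdoub.exists_partition (hε2 j)
  have hfill : ∀ (j : ℕ) (x : M) (σ : Finset M), σ.Nonempty → σ.card ≤ 2 * D →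
      ↑σ ⊆ ball x (2 * (ε / 2 ^ j)) → ContinuousOn G (simplexOn σ) ∧
        ∀ w ∈ simplexOn σ, dist (G w) x ≤ 2 * K * (ε / 2 ^ j) := by
    intro j x σ hne hc hσ
    have hsmall : 2 * (ε / 2 ^ j) * K ≤ 1 := by
      have := hεle j
      nlinarith
    obtain ⟨h1, h2⟩ := hG σ hne (by omega) x _ hsmall hσ
    refine ⟨h1, fun w hw => ?_⟩
    have := h2 hw
    rw [mem_ball] at this
    linarith
  set F : Finset (Finset (Fin (V 0).card)) := Finset.univ.filter fun τ =>
    τ.Nonempty ∧ ∃ x : M, ((τ.map (enumEmbedding (V 0)) : Finset M) : Set M) ⊆ ball x (2 * ε)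
    with hF
  have hmemF : ∀ τ, τ ∈ F ↔ τ.Nonempty ∧ ∃ x : M,
      ((τ.map (enumEmbedding (V 0)) : Finset M) : Set M) ⊆ ball x (2 * ε) := fun τ => by
    simp [hF]
  have hmapV : ∀ τ : Finset (Fin (V 0).card), τ.map (enumEmbedding (V 0)) ⊆ V 0 := fun τ y hy => by
    obtain ⟨i, -, rfl⟩ := Finset.mem_map.1 hy
    exact enumEmbedding_mem _ i
  have hcardF : ∀ (τ : Finset (Fin (V 0).card)) (x : M),
      ((τ.map (enumEmbedding (V 0)) : Finset M) : Set M) ⊆ ball x (2 * ε) → τ.card ≤ D := by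
    intro τ x hx
    rw [← Finset.card_map (enumEmbedding (V 0))]
    exact hcard 0 x _ (hmapV τ) (by simpa using hx)
  set f : M → EuclideanSpace ℝ (Fin (V 0).card) :=
    fun x => WithLp.toLp 2 fun i => φ 0 x (enumEmbedding (V 0) i) with hf
  have hfφ : ∀ x, extendByZero (V 0) (f x) = φ 0 x := fun x => by
    obtain ⟨σ, hσV, -, hσ⟩ := hφσ 0 x
    exact extendByZero_toLp (V 0) fun y hy => hσ.2.1 y fun h => hy (hσV h)
  have hfcell : ∀ x, ∃ τ ∈ F,
      ((τ.map (enumEmbedding (V 0)) : Finset M) : Set M) ⊆ ball x (2 * ε) ∧ f x ∈ cellOf τ := by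
    intro x
    obtain ⟨σ, hσV, hσx, hσ⟩ := hφσ 0 x
    obtain ⟨τ, rfl⟩ := exists_map_enumEmbedding_eq (V 0) hσV
    rw [pow_zero, div_one] at hσx
    refine ⟨τ, (hmemF τ).2 ⟨by simpa using nonempty_of_mem_simplexOn hσ, x, hσx⟩, hσx, ?_⟩
    rw [mem_cellOf_iff, ← extendByZero_mem_simplexOn_iff, hfφ]
    exact hσ
  have hfillF : ∀ (τ : Finset (Fin (V 0).card)) (x : M), τ ∈ F →
      ((τ.map (enumEmbedding (V 0)) : Finset M) : Set M) ⊆ ball x (2 * ε) →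
      ContinuousOn G (simplexOn (τ.map (enumEmbedding (V 0)))) ∧
        ∀ w ∈ cellOf τ, dist (G (extendByZero (V 0) w)) x ≤ 2 * K * ε := by
    intro τ x hτ hx
    have hc := hcardF τ x hx
    obtain ⟨h1, h2⟩ := hfill 0 x (τ.map (enumEmbedding (V 0)))
      (by simpa using ((hmemF τ).1 hτ).1) (by rw [Finset.card_map]; omega) (by simpa using hx)
    refine ⟨h1, fun w hw => ?_⟩
    have := h2 _ ((extendByZero_mem_simplexOn_iff (V 0)).2 (mem_cellOf_iff.1 hw))
    simpa using this
  have hcellreal : ∀ τ ∈ F, cellOf τ ⊆ realization F := fun τ hτ w hw =>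
    mem_iUnion₂.2 ⟨τ, hτ, hw⟩
  have hflip : LipschitzWith (Real.toNNReal C) f := by
    refine LipschitzWith.of_dist_le_mul fun x y => ?_
    rw [Real.coe_toNNReal _ (by linarith), dist_eq_norm]
    refine (EuclideanSpace.norm_le_sum_abs _).trans ?_
    have := hφL 0 x y
    rw [pow_zero, div_one, ← sum_enumEmbedding (V 0)] at this
    exact this
  have hgc : ContinuousOn (fun w => G (extendByZero (V 0) w)) (realization F) := by
    refine continuousOn_comp_of_simplices (V 0) (continuous_extendByZero _).continuousOn
      fun w hw => ?_
    obtain ⟨τ, hτ, hw⟩ := mem_iUnion₂.1 hw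
    obtain ⟨x, hx⟩ := ((hmemF τ).1 hτ).2
    exact ⟨_, hmapV τ, (extendByZero_mem_simplexOn_iff _).2 (mem_cellOf_iff.1 hw),
      (hfillF τ x hτ hx).1⟩
  refine ⟨(V 0).card, F, f, fun w => G (extendByZero (V 0) w), ?_, ?_, ?_, ?_, hflip, ?_, hgc, ?_⟩
  · obtain ⟨x⟩ := hMne
    obtain ⟨σ, hσV, -, hσ⟩ := hφσ 0 x
    exact Finset.card_pos.2 ((nonempty_of_mem_simplexOn hσ).mono hσV)
  · obtain ⟨x⟩ := hMne
    obtain ⟨τ, hτ, -⟩ := hfcell x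
    exact ⟨τ, hτ⟩
  · intro τ hτ
    obtain ⟨hne, x, hx⟩ := (hmemF τ).1 hτ
    exact ⟨hne, (hcardF τ x hx).trans (Nat.le_succ D)⟩
  · intro σ hσ τ hτσ hτ
    obtain ⟨-, x, hx⟩ := (hmemF σ).1 hσ
    refine (hmemF τ).2 ⟨hτ, x, Subset.trans ?_ hx⟩
    exact Finset.coe_subset.2 (Finset.map_subset_map.2 hτσ)
  · intro x
    obtain ⟨τ, hτ, -, hx⟩ := hfcell x
    exact hcellreal τ hτ hx
  · intro p hp hpF
    set A : ℝ × M → EuclideanSpace ℝ (Fin (V 0).card) :=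
      fun q => (1 - q.1) • p (f q.2) + q.1 • f q.2 with hA
    have hAcell : ∀ t ∈ Icc (0 : ℝ) 1, ∀ x, ∃ τ ∈ F,
        ((τ.map (enumEmbedding (V 0)) : Finset M) : Set M) ⊆ ball x (2 * ε) ∧
          A (t, x) ∈ cellOf τ := by
      intro t ht x
      obtain ⟨τ, hτ, hb, hx⟩ := hfcell x
      refine ⟨τ, hτ, hb, ?_⟩
      exact convex_convexHull ℝ _ (hpF τ hτ hx) hx (sub_nonneg.2 ht.2) ht.1 (by ring)
    have hAc : ContinuousOn A (Icc 0 1 ×ˢ univ) := by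
      have hpf : ContinuousOn (fun q : ℝ × M => p (f q.2)) (Icc 0 1 ×ˢ univ) := by
        refine hp.comp (f := fun q : ℝ × M => f q.2)
          (hflip.continuous.comp continuous_snd).continuousOn fun q _ => ?_
        obtain ⟨τ, hτ, -, hx⟩ := hfcell q.2
        exact hcellreal τ hτ hx
      have hf2 : Continuous fun q : ℝ × M => f q.2 := hflip.continuous.comp continuous_snd
      exact ((continuous_const.sub continuous_fst).continuousOn.smul hpf).add
        (continuous_fst.smul hf2).continuousOn
    set W : ℕ → ℝ × M → M → ℝ := fun j q => (1 - q.1) • φ j q.2 + q.1 • φ (j + 1) q.2 with hW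
    have hWc : ∀ j, Continuous (W j) := fun j => by
      have h1 : Continuous fun q : ℝ × M => φ j q.2 := (hφc j).comp continuous_snd
      have h2 : Continuous fun q : ℝ × M => φ (j + 1) q.2 := (hφc (j + 1)).comp continuous_snd
      fun_prop
    have hWmem : ∀ (j : ℕ), ∀ t ∈ Icc (0 : ℝ) 1, ∀ x, ∃ σ ⊆ V j ∪ V (j + 1), σ.card ≤ 2 * D ∧
        ↑σ ⊆ ball x (2 * (ε / 2 ^ j)) ∧ W j (t, x) ∈ simplexOn σ := by
      intro j t ht x
      obtain ⟨σ, hσV, hσx, hσ⟩ := hφσ j x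
      obtain ⟨σ', hσV', hσx', hσ'⟩ := hφσ (j + 1) x
      have h1 := hcard j x σ hσV hσx
      have h2 := hcard (j + 1) x σ' hσV' hσx'
      refine ⟨σ ∪ σ', Finset.union_subset_union hσV hσV',
        (Finset.card_union_le _ _).trans (by omega), ?_, ?_⟩
      · rw [Finset.coe_union]
        refine union_subset hσx (hσx'.trans (ball_subset_ball ?_))
        gcongr
        · norm_num
        · omega
      · exact convex_simplexOn _ (simplexOn_mono Finset.subset_union_left hσ)
          (simplexOn_mono Finset.subset_union_right hσ') (sub_nonneg.2 ht.2) ht.1 (by ring)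
    have hWd : ∀ (j : ℕ), ∀ t ∈ Icc (0 : ℝ) 1, ∀ x,
        dist (G (W j (t, x))) x ≤ 2 * K * (ε / 2 ^ j) := fun j t ht x => by
      obtain ⟨σ, -, hc, hx, hσ⟩ := hWmem j t ht x
      exact (hfill j x σ (nonempty_of_mem_simplexOn hσ) hc hx).2 _ hσ
    have hAd : ∀ t ∈ Icc (0 : ℝ) 1, ∀ x,
        dist (G (extendByZero (V 0) (A (t, x)))) x ≤ 2 * K * ε := fun t ht x => by
      obtain ⟨τ, hτ, hx, hmem⟩ := hAcell t ht x
      exact (hfillF τ x hτ hx).2 _ hmem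
    refine (exists_homotopy_of_seq (M := M) (c := 1 / 4)
      (H := fun j t x => Nat.casesOn j (G (extendByZero (V 0) (A (t, x))))
        fun j => G (W j (t, x)))
      (η := fun j => Nat.casesOn j (2 * K * ε) fun j => 2 * K * (ε / 2 ^ j)) ?_ ?_ ?_ ?_ ?_).imp
      fun h hh => ⟨hh.1, hh.2.1, fun x => by simpa [hA] using hh.2.2.1 x, hh.2.2.2⟩
    · refine (tendsto_add_atTop_iff_nat 1).1 ?_
      have h2 : Tendsto (fun j : ℕ => (2 : ℝ) ^ j) atTop atTop :=
        tendsto_pow_atTop_atTop_of_one_lt one_lt_two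
      simpa using (h2.const_div_atTop ε).const_mul (2 * K)
    · rintro (_ | j)
      · show 2 * K * ε ≤ 1 / 4
        linarith
      · show 2 * K * (ε / 2 ^ j) ≤ 1 / 4
        have := hεle j
        nlinarith
    · rintro (_ | j)
      · refine hgc.comp hAc ?_
        rintro ⟨t, x⟩ ⟨ht, -⟩
        obtain ⟨τ, hτ, -, hx⟩ := hAcell t ht x
        exact hcellreal τ hτ hx
      · refine continuousOn_comp_of_simplices (V j ∪ V (j + 1)) (hWc j).continuousOn ?_
        rintro ⟨t, x⟩ ⟨ht, -⟩
        obtain ⟨σ, hσV, hc, hx, hσ⟩ := hWmem j t ht x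
        exact ⟨σ, hσV, hσ, (hfill j x σ (nonempty_of_mem_simplexOn hσ) hc hx).1⟩
    · rintro (_ | j) x
      · simp [hA, hW, hfφ]
      · simp [hW]
    · rintro (_ | j) t ht x
      · exact hAd t ht x
      · exact hWd j t ht x

end Main
end

section
/- Let (M,d) be a connected metric manifold of dimension n ≥ 1, let S ⊆ M be a closed set, and suppose there exist points x, y ∈ M ∖ S lying in different connected components of M ∖ S. Then the (n−1)-dimensional Hausdorff measure of S is strictly positive: H_{n−1}(S) > 0. -/
open Metric MeasureTheory

theorem ContinuousLinearMap.exists_det_one_add_smul_eval {E : Type*} [NormedAddCommGroup E]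
    [NormedSpace ℝ E] [FiniteDimensional ℝ E] (A : E →L[ℝ] E) :
    ∃ p : Polynomial ℝ, p.degree < (Module.finrank ℝ E + 1 : ℕ) ∧
      ∀ t : ℝ, p.eval t = (1 + t • A).det := by
  let b := Module.finBasis ℝ E
  let M := LinearMap.toMatrix b b (A : E →ₗ[ℝ] E)
  refine ⟨((Polynomial.X : Polynomial ℝ) • M.map Polynomial.C
    + (1 : Matrix _ _ ℝ).map Polynomial.C).det, ?_, fun t => ?_⟩
  · have h := Polynomial.natDegree_det_X_add_C_le M 1
    rw [Fintype.card_fin] at h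
    exact Polynomial.degree_le_natDegree.trans_lt (by exact_mod_cast Nat.lt_succ_of_le h)
  · rw [ContinuousLinearMap.det, ← LinearMap.det_toMatrix b, ← Polynomial.coe_evalRingHom,
      RingHom.map_det]
    congr 1
    ext i j
    simp only [LinearMap.toMatrix_apply, M, Polynomial.coe_evalRingHom, RingHom.mapMatrix_apply,
      Matrix.map_apply, Matrix.add_apply, Matrix.smul_apply, Matrix.one_apply]
    by_cases hij : i = j <;> simp [hij, mul_comm t, add_comm]

theorem ContinuousLinearMap.det_one_add_pos {E : Type*} [NormedAddCommGroup E]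
    [NormedSpace ℝ E] [FiniteDimensional ℝ E] {A : E →L[ℝ] E} (hA : ‖A‖ < 1) :
    0 < (1 + A).det := by
  obtain ⟨p, -, hp⟩ := A.exists_det_one_add_smul_eval
  have hne : ∀ t ∈ Set.Icc (0 : ℝ) 1, p.eval t ≠ 0 := by
    intro t ht h0
    rw [hp] at h0
    have hlt : ‖-(t • A)‖ < 1 := by
      rw [norm_neg, norm_smul, Real.norm_of_nonneg ht.1]
      exact (mul_le_of_le_one_left (norm_nonneg _) ht.2).trans_lt hA
    have hu := (isUnit_one_sub_of_norm_lt_one hlt)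
    rw [sub_neg_eq_add] at hu
    have h2 := (hu.map (ContinuousLinearMap.toLinearMapRingHom : (E →L[ℝ] E) →+* _)).map LinearMap.det
    exact h2.ne_zero h0
  by_contra hcon
  have h1 : p.eval 1 ≤ 0 := by rw [hp]; simpa using hcon
  have h0 : 0 ≤ p.eval 0 := by simp [hp, ContinuousLinearMap.det]
  obtain ⟨t, ht, h⟩ := intermediate_value_Icc' (zero_le_one (α := ℝ))
    (f := fun t => p.eval t) p.continuous.continuousOn ⟨h1, h0⟩
  exact hne t ht h

theorem LipschitzOnWith.indicator_closedBall {E : Type*} [NormedAddCommGroup E] [NormedSpace ℝ E]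
    {k : E → E} {K : NNReal} {R : ℝ} (hk : LipschitzOnWith K k (closedBall 0 R))
    (hk0 : ∀ x, ‖x‖ = R → k x = 0) : LipschitzWith K ((closedBall 0 R).indicator k) := by
  have key : ∀ x y : E, ‖x‖ ≤ R → R < ‖y‖ → dist (k x) 0 ≤ K * dist x y := by
    intro x y hx hy
    obtain ⟨s, hs, hsR⟩ := intermediate_value_Icc (zero_le_one (α := ℝ))
      (f := fun s : ℝ => ‖AffineMap.lineMap x y s‖)
      (continuous_norm.comp AffineMap.lineMap_continuous).continuousOn
      (show R ∈ Set.Icc _ _ by simpa using ⟨hx, hy.le⟩)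
    simp only at hsR
    rw [← hk0 _ hsR]
    refine (hk.dist_le_mul x (by simpa using hx) _ (by simpa using hsR.le)).trans ?_
    gcongr
    rw [dist_left_lineMap, Real.norm_of_nonneg hs.1]
    exact mul_le_of_le_one_left dist_nonneg hs.2
  refine LipschitzWith.of_dist_le_mul fun x y => ?_
  by_cases hx : x ∈ closedBall (0 : E) R <;> by_cases hy : y ∈ closedBall (0 : E) R
  · simpa [hx, hy] using hk.dist_le_mul x hx y hy
  · rw [Set.indicator_of_mem hx, Set.indicator_of_notMem hy]
    exact key x y (by simpa using hx) (by simpa using hy)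
  · rw [Set.indicator_of_mem hy, Set.indicator_of_notMem hx, dist_comm, dist_comm x]
    exact key y x (by simpa using hy) (by simpa using hx)
  · simp only [Set.indicator_of_notMem hx, Set.indicator_of_notMem hy, dist_self]
    positivity

theorem bijOn_closedBall_id_add_smul {E : Type*} [NormedAddCommGroup E] [NormedSpace ℝ E]
    [CompleteSpace E] {r : E → E} {K : NNReal} {R t : ℝ}
    (hK : LipschitzOnWith K (fun x => r x - x) (closedBall 0 R))
    (hr : ∀ x, ‖r x‖ ≤ R) (hid : ∀ x, ‖x‖ = R → r x = x)
    (ht0 : 0 ≤ t) (ht1 : t ≤ 1) (htK : t * K < 1) :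
    Set.BijOn (fun x => x + t • (r x - x)) (closedBall 0 R) (closedBall 0 R) := by
  refine ⟨fun x hx => ?_, fun x hx y hy hxy => ?_, fun y hy => ?_⟩
  · have h : x + t • (r x - x) = (1 - t) • x + t • r x := by module
    simp only [h]
    exact convex_closedBall (0 : E) R hx (by simpa using hr x) (by linarith) ht0 (by ring)
  · by_contra hne
    have hpos : 0 < dist x y := dist_pos.2 hne
    have h1 : x - y = t • ((r y - y) - (r x - x)) := by
      have h2 : x + t • (r x - x) = y + t • (r y - y) := hxy
      rw [smul_sub, sub_eq_sub_iff_add_eq_add, h2, add_comm]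
    have h3 := hK.dist_le_mul y hy x hx
    have h4 : dist x y = t * dist (r y - y) (r x - x) := by
      rw [dist_eq_norm x y, h1, norm_smul, Real.norm_of_nonneg ht0, dist_eq_norm]
    rw [dist_comm y x] at h3
    nlinarith
  · set k := (closedBall (0 : E) R).indicator fun x => r x - x with hkdef
    have hk : LipschitzWith K k := hK.indicator_closedBall fun x hx => by simp [hid x hx]
    have hc : ContractingWith (t.toNNReal * K) fun x => y - t • k x := by
      refine ⟨?_, LipschitzWith.of_dist_le_mul fun a b => ?_⟩
      · rw [← NNReal.coe_lt_coe]; simpa [ht0] using htK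
      · rw [dist_sub_left, dist_smul₀, Real.norm_of_nonneg ht0]
        have := hk.dist_le_mul a b
        simp only [NNReal.coe_mul, Real.coe_toNNReal t ht0]
        nlinarith
    set x := hc.fixedPoint with hxdef
    have hx : y - t • k x = x := hc.fixedPoint_isFixedPt
    by_cases hxR : x ∈ closedBall (0 : E) R
    · refine ⟨x, hxR, ?_⟩
      have : k x = r x - x := Set.indicator_of_mem hxR _
      rw [this] at hx
      change x + t • (r x - x) = y
      rw [← eq_sub_iff_add_eq, hx]
    · have : k x = 0 := Set.indicator_of_notMem hxR _
      rw [this, smul_zero, sub_zero] at hx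
      exact absurd (hx ▸ hy) hxR

theorem not_exists_contDiff_retraction_sphere {E : Type*} [NormedAddCommGroup E]
    [InnerProductSpace ℝ E] [FiniteDimensional ℝ E] {r : E → E} {R : ℝ} (hR : 0 < R)
    (hr : ContDiff ℝ 1 r) (hnorm : ∀ x, ‖r x‖ = R) (hid : ∀ x, ‖x‖ = R → r x = x) : False := by
  let _ : MeasurableSpace E := borel E
  have _ : BorelSpace E := ⟨rfl⟩
  set μ : Measure E := volume
  set B := closedBall (0 : E) R with hB
  set A : E → E →L[ℝ] E := fun x => fderiv ℝ r x - 1 with hA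
  have hAc : Continuous A := (hr.continuous_fderiv one_ne_zero).sub continuous_const
  have hBc : IsCompact B := isCompact_closedBall 0 R
  obtain ⟨C, hC⟩ := hBc.exists_bound_of_continuousOn hAc.continuousOn
  set K : NNReal := C.toNNReal with hKdef
  have hCK : C ≤ K := Real.le_coe_toNNReal C
  have hdiff : ∀ x, HasFDerivAt r (fderiv ℝ r x) x := fun x =>
    (hr.differentiable one_ne_zero x).hasFDerivAt
  have hdiff' : ∀ x, HasFDerivAt (fun x => r x - x) (A x) x := fun x =>
    (hdiff x).sub (hasFDerivAt_id x)
  have hLip : LipschitzOnWith K (fun x => r x - x) B := by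
    refine (convex_closedBall (0 : E) R).lipschitzOnWith_of_nnnorm_hasFDerivWithin_le
      (fun x _ => (hdiff' x).hasFDerivWithinAt) fun x hx => ?_
    exact_mod_cast (hC x hx).trans hCK
  have hdetc : ∀ t : ℝ, Continuous fun x => (1 + t • A x).det := fun t =>
    ContinuousLinearMap.continuous_det.comp (continuous_const.add (hAc.const_smul t))
  have hint : ∀ t : ℝ, IntegrableOn (fun x => (1 + t • A x).det) B μ := fun t =>
    (hdetc t).continuousOn.integrableOn_compact hBc
  have hsmall : ∀ t : ℝ, 0 ≤ t → t ≤ 1 → t * K < 1 →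
      ∫ x in B, (1 + t • A x).det ∂μ = μ.real B := by
    intro t ht0 ht1 htK
    have hbij := bijOn_closedBall_id_add_smul hLip (fun x => (hnorm x).le) hid ht0 ht1 htK
    have h := lintegral_abs_det_fderiv_eq_addHaar_image μ (s := B)
      (f := fun x => x + t • (r x - x)) (f' := fun x => 1 + t • A x)
      isClosed_closedBall.measurableSet
      (fun x _ => ((hasFDerivAt_id x).add ((hdiff' x).const_smul t)).hasFDerivWithinAt) hbij.injOn
    rw [hbij.image_eq] at h
    have hpos : ∀ x ∈ B, 0 < (1 + t • A x).det := fun x hx => by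
      apply ContinuousLinearMap.det_one_add_pos
      rw [norm_smul, Real.norm_of_nonneg ht0]
      exact (mul_le_mul_of_nonneg_left ((hC x hx).trans hCK) ht0).trans_lt htK
    have hae : ∀ᵐ x ∂μ.restrict B, 0 ≤ (1 + t • A x).det :=
      (ae_restrict_iff' isClosed_closedBall.measurableSet).2
        (Filter.Eventually.of_forall fun x hx => (hpos x hx).le)
    rw [integral_eq_lintegral_of_nonneg_ae hae (hdetc t).aestronglyMeasurable, Measure.real, ← h]
    congr 1
    refine setLIntegral_congr_fun isClosed_closedBall.measurableSet fun x hx => ?_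
    simp only [abs_of_pos (hpos x hx)]
  have hzero : ∀ x, (1 + (1 : ℝ) • A x).det = 0 := by
    intro x
    have h1 : 1 + (1 : ℝ) • A x = fderiv ℝ r x := by simp [hA]
    rw [h1]
    by_contra hne
    have hsurj : Function.Surjective (fderiv ℝ r x) := by
      have := (LinearMap.equivOfDetNeZero _ hne).surjective
      exact this
    obtain ⟨v, hv⟩ := hsurj (r x)
    have hconst : HasFDerivAt (fun y => inner ℝ (r y) (r y)) (0 : E →L[ℝ] ℝ) x := by
      have : (fun y => inner ℝ (r y) (r y)) = fun _ => R ^ 2 := by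
        ext y; rw [real_inner_self_eq_norm_sq, hnorm]
      rw [this]; exact hasFDerivAt_const _ _
    have h2 := ((hdiff x).inner ℝ (hdiff x)).unique hconst
    have h3 := DFunLike.congr_fun h2 v
    simp [hv] at h3
    have := hnorm x
    simp [h3] at this
    exact hR.ne this
  set N := Module.finrank ℝ E + 1
  set t₀ : ℝ := 1 / (K + 1) with ht₀
  have ht₀pos : 0 < t₀ := by positivity
  have ht₀1 : t₀ ≤ 1 := by
    rw [ht₀, div_le_one (by positivity)]; simp
  have ht₀K : t₀ * K < 1 := by
    rw [ht₀, one_div, inv_mul_lt_iff₀ (by positivity)]; simp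
  set v : ℕ → ℝ := fun j => t₀ / (j + 1) with hv
  have hvinj : Set.InjOn v (Finset.range N : Set ℕ) := by
    intro i _ j _ hij
    simp only [hv] at hij
    field_simp at hij
    have h : (i : ℝ) = j := by linarith
    exact_mod_cast h
  set w : ℕ → ℝ := fun j => (Lagrange.basis (Finset.range N) v j).eval 1 with hw
  have hinterp : ∀ x, (1 + (1 : ℝ) • A x).det
      = ∑ j ∈ Finset.range N, (1 + v j • A x).det * w j := by
    intro x
    obtain ⟨p, hpdeg, hp⟩ := (A x).exists_det_one_add_smul_eval
    have := Lagrange.eq_interpolate (f := p) hvinj (by rwa [Finset.card_range])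
    rw [← hp, this, Lagrange.interpolate_apply, Polynomial.eval_finsetSum]
    simp [hp, hw]
  have hvsmall : ∀ j, ∫ x in B, (1 + v j • A x).det ∂μ = μ.real B := by
    intro j
    have h0 : 0 ≤ v j := by positivity
    have h1 : v j ≤ t₀ := div_le_self ht₀pos.le (by simp)
    exact hsmall _ h0 (h1.trans ht₀1)
      ((mul_le_mul_of_nonneg_right h1 K.coe_nonneg).trans_lt ht₀K)
  have hsum : ∑ j ∈ Finset.range N, w j = 1 := by
    have := congrArg (Polynomial.eval 1) (Lagrange.sum_basis hvinj ⟨0, by simp [N]⟩)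
    simpa [Polynomial.eval_finsetSum] using this
  have hvol : μ.real B = 0 := by
    calc μ.real B = ∑ j ∈ Finset.range N, μ.real B * w j := by
          rw [← Finset.mul_sum, hsum, mul_one]
      _ = ∑ j ∈ Finset.range N, ∫ x in B, (1 + v j • A x).det * w j ∂μ := by
          refine Finset.sum_congr rfl fun j _ => ?_
          rw [integral_mul_const, hvsmall]
      _ = ∫ x in B, ∑ j ∈ Finset.range N, (1 + v j • A x).det * w j ∂μ :=
          (integral_finsetSum _ fun j _ => (hint _).mul_const _).symm
      _ = 0 := by
          simp_rw [← hinterp, hzero]; simp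
  have hpos : 0 < μ.real B :=
    ENNReal.toReal_pos (measure_closedBall_pos μ 0 hR).ne' hBc.measure_lt_top.ne
  exact hpos.ne' hvol

theorem Continuous.exists_eq_zero_of_eq_id_of_le_norm {E : Type*} [NormedAddCommGroup E]
    [InnerProductSpace ℝ E] [FiniteDimensional ℝ E] {H : E → E} {R : ℝ} (hR : 0 < R)
    (hH : Continuous H) (hid : ∀ x, R ≤ ‖x‖ → H x = x) : ∃ x, H x = 0 := by
  by_contra! hne
  obtain ⟨z, -, hz⟩ := (isCompact_closedBall (0 : E) R).exists_isMinOn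
    ⟨0, by simp [hR.le]⟩ hH.norm.continuousOn
  obtain ⟨g, hg, hgd, hgs⟩ := (hH.sub continuous_id).exists_contDiff_approx 1
    (ε := fun _ => ‖H z‖) continuous_const (fun _ => norm_pos_iff.2 (hne z))
  have hgz : ∀ x, R ≤ ‖x‖ → g x = 0 := by
    intro x hx
    by_contra h
    exact hgs h (by simp [hid x hx])
  have hs : ∀ x, x + g x ≠ 0 := by
    intro x h0
    rcases le_total R ‖x‖ with hx | hx
    · rw [hgz x hx, add_zero] at h0
      rw [h0, norm_zero] at hx
      exact hR.not_ge hx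
    · have h1 := hgd x
      have h2 : ‖H z‖ ≤ ‖H x‖ := hz (by simpa using hx)
      rw [eq_neg_of_add_eq_zero_right h0, dist_eq_norm, norm_sub_rev] at h1
      simp at h1
      linarith
  have hsm : ContDiff ℝ 1 fun x => x + g x := contDiff_id.add hg
  refine not_exists_contDiff_retraction_sphere (r := fun x => (R / ‖x + g x‖) • (x + g x)) hR
    ((contDiff_const.div (hsm.norm ℝ hs) fun x => (norm_pos_iff.2 (hs x)).ne').smul hsm)
    (fun x => ?_) fun x hx => ?_
  · have := norm_pos_iff.2 (hs x)
    rw [norm_smul, Real.norm_of_nonneg (by positivity), div_mul_cancel₀ _ this.ne']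
  · simp [hgz x hx.ge, hx, hR.ne']

/-- A form of the Poincaré–Miranda theorem. -/
theorem Continuous.exists_eq_zero_of_sign {ι : Type*} [Fintype ι] {F : (ι → ℝ) → ι → ℝ}
    (hF : Continuous F) (hpos : ∀ x i, 1 ≤ x i → 0 < F x i)
    (hneg : ∀ x i, x i ≤ -1 → F x i < 0) : ∃ x, F x = 0 := by
  set m : ℝ := (Fintype.card ι : ℝ) with hm
  set s : EuclideanSpace ℝ ι → ℝ := fun x => max 0 (min 1 (‖x‖ - m)) with hs
  set H : EuclideanSpace ℝ ι → EuclideanSpace ℝ ι := fun x =>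
    (1 - s x) • WithLp.toLp 2 (F x.ofLp) + s x • x with hH
  have hsc : Continuous s := by fun_prop
  have hHc : Continuous H := by
    refine ((continuous_const.sub hsc).smul ?_).add (hsc.smul continuous_id)
    exact (PiLp.continuous_toLp 2 _).comp (hF.comp (PiLp.continuous_ofLp 2 _))
  obtain ⟨x, hx⟩ := hHc.exists_eq_zero_of_eq_id_of_le_norm (R := m + 1) (by positivity) (by
    intro x hx
    have : s x = 1 := by
      simp only [hs]
      rw [min_eq_left (by linarith), max_eq_right zero_le_one]
    simp [hH, this])
  have hs0 : 0 ≤ s x := le_max_left _ _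
  have hs1 : s x ≤ 1 := max_le zero_le_one (min_le_left _ _)
  have hcoord : ∀ i, (1 - s x) * F x.ofLp i + s x * x i = 0 := by
    intro i
    simpa [hH] using congrArg (fun y : EuclideanSpace ℝ ι => y i) hx
  have hlt : ∀ i, |x i| < 1 := by
    intro i
    by_contra! hi
    have hc := hcoord i
    rcases le_abs.1 hi with h | h
    · have := hpos x.ofLp i h
      rcases hs0.eq_or_lt with h0 | h0
      · rw [← h0] at hc; linarith
      · nlinarith [mul_pos h0 (show 0 < x i by linarith), mul_nonneg (sub_nonneg.2 hs1) this.le]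
    · have := hneg x.ofLp i (by linarith)
      rcases hs0.eq_or_lt with h0 | h0
      · rw [← h0] at hc; linarith
      · nlinarith [mul_pos h0 (show 0 < -x i by linarith),
          mul_nonneg (sub_nonneg.2 hs1) (neg_pos.2 this).le]
  have hnorm : ‖x‖ ≤ m := by
    have h1 : ‖x‖ ^ 2 ≤ m := by
      rw [EuclideanSpace.real_norm_sq_eq, hm, ← nsmul_one, ← Finset.card_univ]
      exact Finset.sum_le_card_nsmul _ _ _ fun i _ => by
        rw [sq_le_one_iff_abs_le_one]; exact (hlt i).le
    rcases Nat.eq_zero_or_pos (Fintype.card ι) with h | h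
    · rw [hm, h] at h1 ⊢
      have := norm_nonneg x
      norm_num at h1 ⊢
      simpa using h1
    · have h2 : (1 : ℝ) ≤ m := by rw [hm]; exact_mod_cast h
      nlinarith [norm_nonneg x]
  have hsx : s x = 0 := by
    simp only [hs]
    exact max_eq_left ((min_le_right _ _).trans (by linarith))
  exact ⟨x.ofLp, funext fun i => by simpa [hsx] using hcoord i⟩

/-- A Besicovitch-type inequality: in a topological cube in a metric space, a set separating two
opposite faces has positive codimension-one Hausdorff measure. -/
theorem hausdorffMeasure_pos_of_separates_faces {ι X : Type*} [Fintype ι] [MetricSpace X]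
    [MeasurableSpace X] [BorelSpace X] {ψ : (ι → ℝ) → X}
    (hψ : ContinuousOn ψ (Set.Icc (-1) 1)) (hinj : Set.InjOn ψ (Set.Icc (-1) 1))
    {U V T : Set X} (hU : IsOpen U) (hV : IsOpen V) (hUV : Disjoint U V) (i : ι)
    (hiU : ∀ x ∈ Set.Icc (-1 : ι → ℝ) 1, x i = -1 → ψ x ∈ U)
    (hiV : ∀ x ∈ Set.Icc (-1 : ι → ℝ) 1, x i = 1 → ψ x ∈ V)
    (hT : ∀ x ∈ Set.Icc (-1 : ι → ℝ) 1, ψ x ∉ U → ψ x ∉ V → ψ x ∈ T) :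
    0 < μH[(Fintype.card ι : ℝ) - 1] T := by
  classical
  have hle : (-1 : ι → ℝ) ≤ 1 := fun _ => by norm_num
  set Q := Set.Icc (-1 : ι → ℝ) 1 with hQ
  have hQc : IsCompact Q := isCompact_Icc
  set c : (ι → ℝ) → ι → ℝ := fun x j => max (-1) (min 1 (x j)) with hc
  have hcc : Continuous c := by fun_prop
  have hcQ : ∀ x, c x ∈ Q := fun x =>
    ⟨fun j => le_max_left _ _, fun j => max_le (by norm_num) (min_le_left _ _)⟩
  have hc1 : ∀ x j, 1 ≤ x j → c x j = 1 := fun x j h => by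
    simp only [hc]; rw [min_eq_left h, max_eq_right (by norm_num)]
  have hc2 : ∀ x j, x j ≤ -1 → c x j = -1 := fun x j h => by
    simp only [hc]; rw [max_eq_left ((min_le_right _ _).trans h)]
  set φ : (ι → ℝ) → X := fun x => ψ (c x) with hφ
  have hφc : Continuous φ := hψ.comp_continuous hcc hcQ
  set face : ι → ℝ → Set X := fun j a => ψ '' (Q ∩ {x | x j = a}) with hface
  have hfc : ∀ j a, IsCompact (face j a) := fun j a =>
    (hQc.inter_right (isClosed_eq (continuous_apply j) continuous_const)).image_of_continuousOn
      (hψ.mono Set.inter_subset_left)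
  have hfne : ∀ j, (face j (-1)).Nonempty := fun j => ⟨_, -1, ⟨⟨le_rfl, hle⟩, rfl⟩, rfl⟩
  have hdisj : ∀ j, Disjoint (face j (-1)) (face j 1) := by
    intro j
    rw [Set.disjoint_left]
    rintro _ ⟨x, ⟨hx, hxj⟩, rfl⟩ ⟨y, ⟨hy, hyj⟩, hxy⟩
    have := hinj hy hx hxy
    simp only [Set.mem_ofPred_eq] at hxj hyj
    rw [this, hxj] at hyj
    norm_num at hyj
  have hdex : ∀ j, ∃ d : ℝ, 0 < d ∧ ∀ p ∈ face j 1, d ≤ infDist p (face j (-1)) := by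
    intro j
    obtain ⟨δ, hδ, hd⟩ := (hdisj j).symm.exists_thickenings (hfc j 1) (hfc j (-1)).isClosed
    refine ⟨δ, hδ, fun p hp => ?_⟩
    by_contra! h
    refine Set.disjoint_left.1 hd (self_subset_thickening hδ _ hp) ?_
    rwa [mem_thickening_iff_infDist_lt (hfne j)]
  choose d hd0 hd using hdex
  set f : X → ({j // j ≠ i} → ℝ) := fun p j => infDist p (face j (-1)) with hf
  have hfL : LipschitzWith 1 f := by
    refine LipschitzWith.of_dist_le_mul fun p q => ?_
    rw [NNReal.coe_one, one_mul, dist_pi_le_iff dist_nonneg]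
    intro j
    simpa using (lipschitz_infDist_pt (face j (-1))).dist_le_mul p q
  set g : X → ℝ := fun p => infDist p Vᶜ - infDist p Uᶜ with hg
  have hgc : Continuous g := (continuous_infDist_pt _).sub (continuous_infDist_pt _)
  have hUc : (Uᶜ).Nonempty :=
    ⟨ψ 1, fun h => Set.disjoint_left.1 hUV h (hiV 1 ⟨hle, le_rfl⟩ rfl)⟩
  have hVc : (Vᶜ).Nonempty :=
    ⟨ψ (-1), fun h => Set.disjoint_left.1 hUV (hiU (-1) ⟨le_rfl, hle⟩ rfl) h⟩
  have hgU : ∀ p ∈ U, g p < 0 := by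
    intro p hp
    have h1 := (hU.isClosed_compl.notMem_iff_infDist_pos hUc).1 (fun h : p ∈ Uᶜ => h hp)
    have h2 : infDist p Vᶜ = 0 :=
      infDist_zero_of_mem (fun h => Set.disjoint_left.1 hUV hp h)
    simp only [hg]; linarith
  have hgV : ∀ p ∈ V, 0 < g p := by
    intro p hp
    have h1 := (hV.isClosed_compl.notMem_iff_infDist_pos hVc).1 (fun h : p ∈ Vᶜ => h hp)
    have h2 : infDist p Uᶜ = 0 :=
      infDist_zero_of_mem (fun h => Set.disjoint_left.1 hUV h hp)
    simp only [hg]; linarith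
  have hsub : (Set.univ.pi fun j : {j // j ≠ i} => Set.Ioo 0 (d j)) ⊆ f '' T := by
    intro t ht
    rw [Set.mem_univ_pi] at ht
    set F : (ι → ℝ) → ι → ℝ := fun x j =>
      if h : j = i then g (φ x) else f (φ x) ⟨j, h⟩ - t ⟨j, h⟩ with hF
    have hFc : Continuous F := by
      refine continuous_pi fun j => ?_
      by_cases h : j = i
      · simp only [hF, h, dite_true]
        exact hgc.comp hφc
      · simp only [hF, h, dite_false]
        exact ((continuous_apply _).comp (hfL.continuous.comp hφc)).sub continuous_const
    obtain ⟨x, hx⟩ := hFc.exists_eq_zero_of_sign (fun x j hxj => by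
        by_cases h : j = i
        · subst h
          simpa [hF] using hgV _ (hiV _ (hcQ x) (hc1 x _ hxj))
        · have := hd j (φ x) ⟨c x, ⟨hcQ x, hc1 x j hxj⟩, rfl⟩
          simpa [hF, h] using (ht ⟨j, h⟩).2.trans_le this) (fun x j hxj => by
        by_cases h : j = i
        · subst h
          simpa [hF] using hgU _ (hiU _ (hcQ x) (hc2 x _ hxj))
        · have h0 : infDist (φ x) (face j (-1)) = 0 :=
            infDist_zero_of_mem ⟨c x, ⟨hcQ x, hc2 x j hxj⟩, rfl⟩
          simpa [hF, h, hf, h0] using (ht ⟨j, h⟩).1)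
    have hgx : g (φ x) = 0 := by simpa [hF] using congrFun hx i
    refine ⟨φ x, hT _ (hcQ x) (fun h => (hgU _ h).ne hgx) (fun h => (hgV _ h).ne' hgx), ?_⟩
    ext ⟨j, hj⟩
    have := congrFun hx j
    simpa [hF, hj, sub_eq_zero] using this
  have hcard : (Fintype.card ι : ℝ) - 1 = Fintype.card {j // j ≠ i} := by
    have h1 : Fintype.card {j // j ≠ i} = Fintype.card ι - 1 := by simp
    rw [h1, Nat.cast_sub (Fintype.card_pos_iff.2 ⟨i⟩), Nat.cast_one]
  rw [hcard]
  calc (0 : ENNReal) < volume (Set.univ.pi fun j : {j // j ≠ i} => Set.Ioo 0 (d j)) := by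
        rw [volume_pi_pi]
        exact CanonicallyOrderedAdd.prod_pos.2 fun j _ => by simpa using hd0 j
    _ ≤ volume (f '' T) := measure_mono hsub
    _ = μH[Fintype.card {j // j ≠ i}] (f '' T) := by rw [hausdorffMeasure_pi_real]
    _ ≤ μH[Fintype.card {j // j ≠ i}] T := by
        simpa using hfL.hausdorffMeasure_image_le (Nat.cast_nonneg _) T

/-- A subset of a metric space that separates a topologically embedded convex open subset of
`ι → ℝ` has positive codimension-one Hausdorff measure. -/
theorem hausdorffMeasure_pos_of_separates_convex {ι X : Type*} [Fintype ι] [MetricSpace X]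
    [MeasurableSpace X] [BorelSpace X] {ψ : (ι → ℝ) → X} {D : Set (ι → ℝ)} (hDo : IsOpen D)
    (hDc : Convex ℝ D) (hψ : ContinuousOn ψ D) (hinj : Set.InjOn ψ D)
    {U V T : Set X} (hU : IsOpen U) (hV : IsOpen V) (hUV : Disjoint U V) {a b : ι → ℝ}
    (ha : a ∈ D) (hb : b ∈ D) (haU : ψ a ∈ U) (hbV : ψ b ∈ V)
    (hT : ∀ x ∈ D, ψ x ∉ U → ψ x ∉ V → ψ x ∈ T) :
    0 < μH[(Fintype.card ι : ℝ) - 1] T := by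
  classical
  have hab : a ≠ b := fun h => Set.disjoint_left.1 hUV haU (h ▸ hbV)
  obtain ⟨i, hi⟩ := Function.ne_iff.1 hab
  obtain ⟨r₁, hr₁, hb₁⟩ := Metric.isOpen_iff.1 (hψ.isOpen_inter_preimage hDo hU) a ⟨ha, haU⟩
  obtain ⟨r₂, hr₂, hb₂⟩ := Metric.isOpen_iff.1 (hψ.isOpen_inter_preimage hDo hV) b ⟨hb, hbV⟩
  obtain ⟨ε, hε, hεr⟩ := exists_between (lt_min hr₁ hr₂)
  set w : (ι → ℝ) → ι → ℝ := fun x j => if j = i then 0 else ε * x j with hw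
  set A : (ι → ℝ) → ι → ℝ := fun x =>
    (1 - (1 + x i) / 2) • (a + w x) + ((1 + x i) / 2) • (b + w x) with hA
  have hwc : Continuous w := by
    refine continuous_pi fun j => ?_
    by_cases h : j = i
    · simp only [hw, h, if_true]; exact continuous_const
    · simp only [hw, h, if_false]; fun_prop
  have hAc : Continuous A := by fun_prop
  have hwn : ∀ x ∈ Set.Icc (-1 : ι → ℝ) 1, ‖w x‖ ≤ ε := by
    intro x hx
    refine (pi_norm_le_iff_of_nonneg hε.le).2 fun j => ?_
    by_cases h : j = i
    · simpa [hw, h] using hε.le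
    · simp only [hw, h, if_false]
      rw [norm_mul, Real.norm_of_nonneg hε.le]
      exact mul_le_of_le_one_right hε.le (abs_le.2 ⟨hx.1 j, hx.2 j⟩)
  have hwa : ∀ x ∈ Set.Icc (-1 : ι → ℝ) 1, a + w x ∈ D ∩ ψ ⁻¹' U := fun x hx => hb₁ <| by
    simpa using (hwn x hx).trans_lt (hεr.trans_le (min_le_left _ _))
  have hwb : ∀ x ∈ Set.Icc (-1 : ι → ℝ) 1, b + w x ∈ D ∩ ψ ⁻¹' V := fun x hx => hb₂ <| by
    simpa using (hwn x hx).trans_lt (hεr.trans_le (min_le_right _ _))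
  have hAD : Set.MapsTo A (Set.Icc (-1) 1) D := fun x hx => by
    have h1 : -1 ≤ x i := hx.1 i
    have h2 : x i ≤ 1 := hx.2 i
    exact hDc (hwa x hx).1 (hwb x hx).1 (by linarith) (by linarith) (by ring)
  have hAapp : ∀ x j, A x j = (1 - (1 + x i) / 2) * a j + (1 + x i) / 2 * b j + w x j := by
    intro x j
    simp only [hA, Pi.add_apply, Pi.smul_apply, smul_eq_mul]
    ring
  have hAinj : Function.Injective A := by
    intro x y hxy
    have hxyi : x i = y i := by
      have h := congrFun hxy i
      simp only [hAapp, hw, if_true] at h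
      have h2 : (x i - y i) * (b i - a i) = 0 := by linear_combination 2 * h
      rcases mul_eq_zero.1 h2 with h3 | h3
      · exact sub_eq_zero.1 h3
      · exact absurd (sub_eq_zero.1 h3).symm hi
    ext j
    by_cases hj : j = i
    · rw [hj, hxyi]
    · have h := congrFun hxy j
      simp only [hAapp, hw, hj, if_false, hxyi] at h
      exact mul_left_cancel₀ hε.ne' (add_left_cancel h)
  refine hausdorffMeasure_pos_of_separates_faces (ψ := ψ ∘ A) (hψ.comp hAc.continuousOn hAD)
    (hinj.comp hAinj.injOn hAD) hU hV hUV i (fun x hx hxi => ?_) (fun x hx hxi => ?_)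
    fun x hx => hT _ (hAD hx)
  · have : A x = a + w x := by simp [hA, hxi]
    simpa [this] using (hwa x hx).2
  · have : A x = b + w x := by simp [hA, hxi]
    simpa [this] using (hwb x hx).2

theorem IsTopManifold.exists_embedding_ball {n : ℕ} {M : Type*} [TopologicalSpace M]
    (hM : IsTopManifold n M) (z : M) :
    ∃ (ψ : (Fin n → ℝ) → M) (c : Fin n → ℝ) (ρ : ℝ), 0 < ρ ∧ ContinuousOn ψ (ball c ρ) ∧
      Set.InjOn ψ (ball c ρ) ∧ IsOpen (ψ '' ball c ρ) ∧ ψ c = z := by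
  classical
  obtain ⟨U, V, hU, hzU, hV, ⟨e⟩⟩ := hM z
  let V' : Set (Fin n → ℝ) := WithLp.toLp 2 ⁻¹' V
  have hV' : IsOpen V' := hV.preimage (PiLp.continuous_toLp 2 _)
  let ψ : (Fin n → ℝ) → M := fun x => if h : x ∈ V' then e.symm ⟨WithLp.toLp 2 x, h⟩ else z
  let c : Fin n → ℝ := (e ⟨z, hzU⟩ : EuclideanSpace ℝ (Fin n)).ofLp
  have hc : c ∈ V' := (e ⟨z, hzU⟩).2
  obtain ⟨ρ, hρ, hb⟩ := Metric.isOpen_iff.1 hV' c hc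
  have hψ : ∀ x (h : x ∈ V'), ψ x = e.symm ⟨WithLp.toLp 2 x, h⟩ := fun x h => dif_pos h
  have hψc : ContinuousOn ψ V' := by
    rw [continuousOn_iff_continuous_domRestrict]
    have : V'.domRestrict ψ = fun x : V' => (e.symm ⟨WithLp.toLp 2 x.1, x.2⟩ : M) :=
      funext fun x => hψ x.1 x.2
    rw [this]
    exact continuous_subtype_val.comp (e.symm.continuous.comp
      (((PiLp.continuous_toLp 2 _).comp continuous_subtype_val).subtype_mk _))
  have hψi : Set.InjOn ψ V' := by
    intro x hx y hy hxy
    rw [hψ x hx, hψ y hy] at hxy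
    simpa using e.symm.injective (Subtype.ext hxy)
  refine ⟨ψ, c, ρ, hρ, hψc.mono hb, hψi.mono hb, ?_, by rw [hψ c hc]; simp [c]⟩
  have himg : ψ '' ball c ρ =
      (↑) '' ((fun u : U => (e u : EuclideanSpace ℝ (Fin n)).ofLp) ⁻¹' ball c ρ) := by
    ext p
    constructor
    · rintro ⟨x, hx, rfl⟩
      refine ⟨e.symm ⟨WithLp.toLp 2 x, hb hx⟩, ?_, (hψ x (hb hx)).symm⟩
      simpa using hx
    · rintro ⟨u, hu, rfl⟩
      refine ⟨_, hu, ?_⟩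
      rw [hψ _ (hb hu)]
      simp
  rw [himg]
  exact hU.isOpenMap_subtype_val _ (isOpen_ball.preimage
    ((PiLp.continuous_ofLp 2 _).comp (continuous_subtype_val.comp e.continuous)))

theorem IsTopManifold.hausdorffMeasure_pos_of_mem_closure {n : ℕ} {M : Type*} [MetricSpace M]
    [MeasurableSpace M] [BorelSpace M] (hM : IsTopManifold n M) {U V S : Set M}
    (hU : IsOpen U) (hV : IsOpen V) (hUV : Disjoint U V) (hS : Sᶜ ⊆ U ∪ V) {z : M}
    (hzU : z ∈ closure U) (hzV : z ∈ closure V) : 0 < μH[(n : ℝ) - 1] S := by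
  obtain ⟨ψ, c, ρ, hρ, hψc, hψi, hψo, rfl⟩ := hM.exists_embedding_ball z
  have hc : ψ c ∈ ψ '' ball c ρ := ⟨c, mem_ball_self hρ, rfl⟩
  obtain ⟨_, ⟨a, ha, rfl⟩, haU⟩ := mem_closure_iff.1 hzU _ hψo hc
  obtain ⟨_, ⟨b, hb, rfl⟩, hbV⟩ := mem_closure_iff.1 hzV _ hψo hc
  simpa using hausdorffMeasure_pos_of_separates_convex isOpen_ball (convex_ball c ρ) hψc hψi hU hV
    hUV ha hb haU hbV (T := S) fun x _ h1 h2 => by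
      by_contra h
      exact (hS h).elim h1 h2

theorem IsTopManifold.hausdorffMeasure_pos_of_mem_interior {n : ℕ} (hn : 1 ≤ n) {M : Type*}
    [MetricSpace M] [MeasurableSpace M] [BorelSpace M] (hM : IsTopManifold n M) {S : Set M} {z : M}
    (hz : z ∈ interior S) : 0 < μH[(n : ℝ) - 1] S := by
  obtain ⟨ψ, c, ρ, hρ, hψc, hψi, hψo, rfl⟩ := hM.exists_embedding_ball z
  obtain ⟨ρ', hρ', hb⟩ := Metric.isOpen_iff.1 (hψc.isOpen_inter_preimage isOpen_ball isOpen_interior)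
    c ⟨mem_ball_self hρ, hz⟩
  obtain ⟨b, hbc, hbb⟩ : ∃ b, b ≠ c ∧ b ∈ ball c ρ' := by
    refine ⟨c + fun _ => ρ' / 2, ?_, ?_⟩
    · intro h
      have := congrFun h ⟨0, hn⟩
      simp [hρ'.ne'] at this
    · rw [mem_ball, dist_self_add_left]
      refine (pi_norm_const_le _).trans_lt ?_
      rw [Real.norm_of_nonneg (by positivity)]
      exact half_lt_self hρ'
  have hsub : ball c ρ' ⊆ ball c ρ := fun x hx => (hb hx).1
  have hne : ψ c ≠ ψ b := fun h =>
    hbc (hψi (hsub (mem_ball_self hρ')) (hsub hbb) h).symm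
  obtain ⟨U, V, hU, hV, hcU, hbV, hUV⟩ := t2_separation hne
  simpa using hausdorffMeasure_pos_of_separates_convex isOpen_ball (convex_ball c ρ')
    (hψc.mono hsub) (hψi.mono hsub) hU hV hUV (mem_ball_self hρ') hbb hcU hbV (T := S)
    fun x hx _ _ => interior_subset (hb hx).2

/-- **Soft lower bound.** If a closed subset `S` of a connected metric `n`-manifold
separates two points `x, y ∈ M \ S` (they lie in different connected components of
`M \ S`), then `H_{n-1}(S) > 0`. -/
theorem separating_set_positive_measure (n : ℕ) (hn : 1 ≤ n)
    (M : Type) [MetricSpace M] [ConnectedSpace M] [MeasurableSpace M] [BorelSpace M]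
    (hM : IsTopManifold n M) (S : Set M) (hS : IsClosed S)
    (x y : M) (hx : x ∈ Sᶜ) (hy : y ∈ Sᶜ)
    (hsep : connectedComponentIn Sᶜ x ≠ connectedComponentIn Sᶜ y) :
    0 < μH[(n : ℝ) - 1] S := by
  by_contra hpos
  have hpre : IsPreconnected Sᶜ := by
    intro U V hU hV hcov hSU hSV
    by_contra hUV
    have hdisj : Disjoint (Sᶜ ∩ U) (Sᶜ ∩ V) := by
      rw [Set.disjoint_left]
      exact fun p hp hq => hUV ⟨p, hp.1, hp.2, hq.2⟩
    have hcover : Sᶜ ⊆ (Sᶜ ∩ U) ∪ (Sᶜ ∩ V) := fun p hp =>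
      (hcov hp).imp (fun h => ⟨hp, h⟩) fun h => ⟨hp, h⟩
    have hdense : closure Sᶜ = Set.univ := by
      rw [closure_compl, Set.compl_univ_iff, Set.eq_empty_iff_forall_notMem]
      exact fun z hz => hpos (hM.hausdorffMeasure_pos_of_mem_interior hn hz)
    have hclo : closure (Sᶜ ∩ U) ∪ closure (Sᶜ ∩ V) = Set.univ := by
      rw [← closure_union]
      exact Set.eq_univ_of_univ_subset (hdense ▸ closure_mono hcover)
    obtain ⟨z, -, hzU, hzV⟩ := isPreconnected_closed_iff.1 isPreconnected_univ _ _
      isClosed_closure isClosed_closure hclo.ge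
      (by simpa using hSU) (by simpa using hSV)
    exact hpos (hM.hausdorffMeasure_pos_of_mem_closure (hS.isOpen_compl.inter hU)
      (hS.isOpen_compl.inter hV) hdisj hcover hzU hzV)
  exact hsep ((hpre.connectedComponentIn hx).trans (hpre.connectedComponentIn hy).symm)
end
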